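/- arXiv:math/0310300 — 4 statements merged into one kernel-verified Lean document; each statement's English description precedes it below -/
import Mathlib

section
/- If ω, ω′ ∈ Ω satisfy ω ≠ ω′ and Π_ρ(ω) = Π_ρ(ω′), then there exists n ∈ ℕ with Π_ρ(ω) + n·ρ = 0 in ℝ/ℤ; that is, Π_ρ is injective except over points of the circle in the backward rotation orbit of 0. -/
open Filter Topology

/-- A solution of the recurrence `u (k + 2) = A k * u (k + 1) + u k` that is negligible with respect
to the denominators `Q` cannot take two consecutive positive values. -/
lemma not_pos_of_tendsto_div_zero {A Q : ℕ → ℕ} (hQ1 : ∀ k, 0 < Q (k + 1))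
    (hQm : ∀ k, Q k ≤ Q (k + 1)) (hQ : ∀ k, Q (k + 2) = A k * Q (k + 1) + Q k)
    {u : ℕ → ℝ} (hu : ∀ k, u (k + 2) = A k * u (k + 1) + u k)
    (hlim : Tendsto (fun k => u k / Q k) atTop (𝓝 0)) (k : ℕ) (h0 : 0 < u k) :
    ¬ 0 < u (k + 1) := by
  intro h1
  have hQpos : (0 : ℝ) < Q (k + 1) := by exact_mod_cast hQ1 k
  obtain ⟨c, hc, hck, hck1⟩ : ∃ c : ℝ, 0 < c ∧ c * Q k ≤ u k ∧ c * Q (k + 1) ≤ u (k + 1) := by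
    refine ⟨min (u k) (u (k + 1)) / Q (k + 1), div_pos (lt_min h0 h1) hQpos, ?_, ?_⟩
    · refine le_trans ?_ (min_le_left (u k) (u (k + 1)))
      rw [div_mul_eq_mul_div, div_le_iff₀ hQpos]
      have : (Q k : ℝ) ≤ Q (k + 1) := by exact_mod_cast hQm k
      exact mul_le_mul_of_nonneg_left this (lt_min h0 h1).le
    · rw [div_mul_cancel₀ _ hQpos.ne']
      exact min_le_right _ _
  have key : ∀ m, c * Q (k + m) ≤ u (k + m) ∧ c * Q (k + m + 1) ≤ u (k + m + 1) := by
    intro m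
    induction m with
    | zero => exact ⟨hck, hck1⟩
    | succ m ih =>
      refine ⟨ih.2, ?_⟩
      have e1 := hu (k + m)
      have e2 : (Q (k + m + 2) : ℝ) = A (k + m) * Q (k + m + 1) + Q (k + m) := by
        exact_mod_cast hQ (k + m)
      have e3 := mul_le_mul_of_nonneg_left ih.2 (Nat.cast_nonneg (α := ℝ) (A (k + m)))
      change c * Q (k + m + 2) ≤ u (k + m + 2)
      rw [e1, e2]
      linarith [ih.1]
  have hcle : c ≤ 0 := by
    refine ge_of_tendsto hlim ?_
    filter_upwards [eventually_ge_atTop (k + 1)] with n hn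
    obtain ⟨m, rfl⟩ := Nat.exists_eq_add_of_le hn
    have hpos : (0 : ℝ) < Q (k + m + 1) := by exact_mod_cast hQ1 (k + m)
    rw [show k + 1 + m = k + m + 1 by ring, le_div_iff₀ hpos]
    exact (key m).2
  linarith

/-- The differences `Q k * ρ - P k` alternate in sign. -/
lemma alternating_sign {A Q P : ℕ → ℕ} (hQ1 : ∀ k, 0 < Q (k + 1))
    (hQm : ∀ k, Q k ≤ Q (k + 1)) (hQ : ∀ k, Q (k + 2) = A k * Q (k + 1) + Q k)
    (hP : ∀ k, P (k + 2) = A k * P (k + 1) + P k) (hQ0 : Q 0 = 0) (hP0 : P 0 = 1)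
    {ρ : ℝ} (hρ : Irrational ρ)
    (hlim : Tendsto (fun k => (P k : ℝ) / Q k) atTop (𝓝 ρ)) (k : ℕ) :
    0 < (-1) ^ (k + 1) * (Q k * ρ - P k) := by
  induction k with
  | zero => simp [hQ0, hP0]
  | succ k ih =>
    have hQpos : (0 : ℝ) < Q (k + 1) := by exact_mod_cast hQ1 k
    have hne : (Q (k + 1) : ℝ) * ρ - P (k + 1) ≠ 0 := by
      intro h
      refine hρ ⟨(P (k + 1) : ℚ) / Q (k + 1), ?_⟩
      push_cast
      rw [div_eq_iff hQpos.ne']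
      linarith
    have hnot := not_pos_of_tendsto_div_zero hQ1 hQm hQ
      (u := fun n => (-1) ^ (k + 1) * (Q n * ρ - P n)) (fun n => by
        simp only [hQ, hP]
        push_cast
        ring) ?_ k ih
    · have hne' : (-1 : ℝ) ^ (k + 1) * (Q (k + 1) * ρ - P (k + 1)) ≠ 0 :=
        mul_ne_zero (pow_ne_zero _ (by norm_num)) hne
      have := lt_of_le_of_ne (not_lt.mp hnot) hne'
      rw [pow_succ]
      linarith
    · have h1 : Tendsto (fun n => (-1 : ℝ) ^ (k + 1) * (ρ - (P n : ℝ) / Q n)) atTop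
          (𝓝 ((-1 : ℝ) ^ (k + 1) * (ρ - ρ))) := (hlim.const_sub ρ).const_mul _
      rw [sub_self, mul_zero] at h1
      refine h1.congr' ?_
      filter_upwards [eventually_ge_atTop 1] with n hn
      obtain ⟨m, rfl⟩ := Nat.exists_eq_add_of_le' hn
      have hpos : (0 : ℝ) < Q (m + 1) := by exact_mod_cast hQ1 m
      field_simp

/-- The closed interval of reals whose expansion starts with the digits summing up to `M k`, where
`x k` is the corresponding partial sum and `d` is the sequence of approximation errors. -/
def cylinder (d : ℕ → ℝ) (Q M : ℕ → ℕ) (x : ℕ → ℝ) (k : ℕ) : Set ℝ :=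
  {y | -d (k + 1) ≤ (-1) ^ k * (y - x k) ∧
    (-1) ^ k * (y - x k) ≤ if M k < Q k then d k else d k - d (k + 1)}

lemma isClosed_cylinder (d : ℕ → ℝ) (Q M : ℕ → ℕ) (x : ℕ → ℝ) (k : ℕ) :
    IsClosed (cylinder d Q M x k) := by
  unfold cylinder
  rw [Set.ofPred_and]
  exact (isClosed_le continuous_const (by fun_prop)).inter
    (isClosed_le (by fun_prop) continuous_const)

section Expansion

variable {A Q : ℕ → ℕ} {d : ℕ → ℝ} {M b : ℕ → ℕ} {x : ℕ → ℝ}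

lemma mem_cylinder_self (hA : ∀ k, 1 ≤ A k) (hd : ∀ k, 0 < d k)
    (hdrec : ∀ k, d (k + 2) = d k - A k * d (k + 1)) (k : ℕ) : x k ∈ cylinder d Q M x k := by
  have h1 : (1 : ℝ) ≤ A k := by exact_mod_cast hA k
  have := mul_le_mul_of_nonneg_right h1 (hd (k + 1)).le
  have := hd k
  have := hd (k + 1)
  have := hd (k + 2)
  have := hdrec k
  constructor
  · simp only [sub_self, mul_zero]
    linarith
  · simp only [sub_self, mul_zero]
    split_ifs <;> linarith

/-- A point of the cylinder of order `k + 1` has the upper bound given by its `k`-th digit. -/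
lemma le_of_mem_cylinder_succ (hx : ∀ k, x (k + 1) = x k + b k * ((-1) ^ k * d (k + 1))) {k : ℕ}
    {y : ℝ} (hy : y ∈ cylinder d Q M x (k + 1)) :
    (-1) ^ k * (y - x k) ≤ b k * d (k + 1) + d (k + 2) := by
  have h := hy.1
  rw [hx k, pow_succ] at h
  rcases neg_one_pow_eq_or ℝ k with e | e <;> rw [e] at h ⊢ <;> linarith

/-- A point of the cylinder of order `k + 1` has the lower bound given by its `k`-th digit. -/
lemma ge_of_mem_cylinder_succ (hM1 : ∀ k, M (k + 1) = M k + b k * Q (k + 1))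
    (hx : ∀ k, x (k + 1) = x k + b k * ((-1) ^ k * d (k + 1))) {k : ℕ}
    {y : ℝ} (hy : y ∈ cylinder d Q M x (k + 1)) (hb : 1 ≤ b k) :
    (b k - 1) * d (k + 1) + d (k + 2) ≤ (-1) ^ k * (y - x k) := by
  have h := hy.2
  have hnot : ¬ M (k + 1) < Q (k + 1) := by
    have := Nat.mul_le_mul_right (Q (k + 1)) hb
    have := hM1 k
    omega
  rw [if_neg hnot, hx k, pow_succ] at h
  rcases neg_one_pow_eq_or ℝ k with e | e <;> rw [e] at h ⊢ <;> linarith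

lemma cylinder_succ_subset (hQm : ∀ k, Q k ≤ Q (k + 1))
    (hQ : ∀ k, Q (k + 2) = A k * Q (k + 1) + Q k) (hd : ∀ k, 0 < d k)
    (hdrec : ∀ k, d (k + 2) = d k - A k * d (k + 1))
    (hM1 : ∀ k, M (k + 1) = M k + b k * Q (k + 1)) (hMQ : ∀ k, M k < Q (k + 1))
    (hx : ∀ k, x (k + 1) = x k + b k * ((-1) ^ k * d (k + 1))) (k : ℕ) :
    cylinder d Q M x (k + 1) ⊆ cylinder d Q M x k := by
  intro y hy
  have hd1 := hd (k + 1)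
  have hd2 := hd (k + 2)
  have hlt : M k + b k * Q (k + 1) < A k * Q (k + 1) + Q k := by
    rw [← hM1, ← hQ]
    exact hMQ (k + 1)
  refine ⟨?_, (le_of_mem_cylinder_succ hx hy).trans ?_⟩
  · rcases Nat.eq_zero_or_pos (b k) with h0 | h0
    · have h := hy.2
      have hlt' : M (k + 1) < Q (k + 1) := by
        rw [hM1, h0, zero_mul, add_zero]
        exact hMQ k
      rw [if_pos hlt', hx k, pow_succ, h0] at h
      push_cast at h
      linarith
    · have h := ge_of_mem_cylinder_succ hM1 hx hy h0
      have h1 : (1 : ℝ) ≤ b k := by exact_mod_cast h0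
      nlinarith
  · rw [hdrec k]
    split_ifs with hcase
    · have hb : b k ≤ A k := by
        by_contra! hcon
        have := Nat.mul_le_mul_right (Q (k + 1)) (Nat.succ_le_of_lt hcon)
        rw [Nat.succ_mul] at this
        have := hQm k
        omega
      have hb' : (b k : ℝ) ≤ A k := by exact_mod_cast hb
      nlinarith
    · have hb : b k + 1 ≤ A k := by
        by_contra! hcon
        have := Nat.mul_le_mul_right (Q (k + 1)) (Nat.lt_succ_iff.mp hcon)
        omega
      have hb' : (b k : ℝ) + 1 ≤ A k := by exact_mod_cast hb
      nlinarith

/-- The limit in the circle of the partial sums of an expansion lifts to a real number lying in all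
the cylinders of the expansion. -/
lemma exists_lift_mem_cylinder (hA : ∀ k, 1 ≤ A k) (hQm : ∀ k, Q k ≤ Q (k + 1))
    (hQ : ∀ k, Q (k + 2) = A k * Q (k + 1) + Q k) (hd : ∀ k, 0 < d k)
    (hdrec : ∀ k, d (k + 2) = d k - A k * d (k + 1))
    (hM1 : ∀ k, M (k + 1) = M k + b k * Q (k + 1)) (hMQ : ∀ k, M k < Q (k + 1))
    (hx : ∀ k, x (k + 1) = x k + b k * ((-1) ^ k * d (k + 1)))
    {z : AddCircle (1 : ℝ)} (hz : Tendsto (fun k => (x k : AddCircle (1 : ℝ))) atTop (𝓝 z)) :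
    ∃ y : ℝ, (y : AddCircle (1 : ℝ)) = z ∧ ∀ k, y ∈ cylinder d Q M x k := by
  have hanti : Antitone (cylinder d Q M x) :=
    antitone_nat_of_succ_le (cylinder_succ_subset hQm hQ hd hdrec hM1 hMQ hx)
  have hself : ∀ k, x k ∈ cylinder d Q M x k := mem_cylinder_self hA hd hdrec
  have hbdd : ∀ k, x k ∈ Set.Icc (x 0 - d 1) (x 0 + d 0) := by
    intro k
    obtain ⟨h1, h2⟩ := hanti (Nat.zero_le k) (hself k)
    have := hd 1
    simp only [zero_add, pow_zero, one_mul] at h1 h2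
    constructor
    · linarith
    · split_ifs at h2 <;> linarith
  obtain ⟨y, -, φ, hφ, hy⟩ := isCompact_Icc.tendsto_subseq hbdd
  refine ⟨y, ?_, fun k => ?_⟩
  · exact tendsto_nhds_unique (((AddCircle.continuous_mk' (1 : ℝ)).tendsto y).comp hy)
      (hz.comp hφ.tendsto_atTop)
  · refine (isClosed_cylinder d Q M x k).mem_of_tendsto hy ?_
    filter_upwards [eventually_ge_atTop k] with m hm
    exact hanti (hm.trans hφ.le_apply) (hself _)

/-- Two expansions of the same real number, the first of which has the smaller digit at the first
place `m` where they differ: then the number is an endpoint of a cylinder. -/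
lemma eq_endpoint_of_digit_lt {M' b' : ℕ → ℕ} {x' : ℕ → ℝ} (hd : ∀ k, 0 < d k)
    (hx : ∀ k, x (k + 1) = x k + b k * ((-1) ^ k * d (k + 1)))
    (hM1' : ∀ k, M' (k + 1) = M' k + b' k * Q (k + 1))
    (hx' : ∀ k, x' (k + 1) = x' k + b' k * ((-1) ^ k * d (k + 1)))
    {y : ℝ} {m : ℕ} (hy : y ∈ cylinder d Q M x (m + 1)) (hy' : y ∈ cylinder d Q M' x' (m + 1))
    (hxx : x m = x' m) (hb : b m < b' m) :
    y = x (m + 1) + (-1) ^ m * d (m + 2) := by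
  have h1 := le_of_mem_cylinder_succ hx hy
  have h2 := ge_of_mem_cylinder_succ hM1' hx' hy' (by omega)
  have hb' : (b m : ℝ) + 1 ≤ b' m := by exact_mod_cast hb
  have hd1 := hd (m + 1)
  rw [← hxx] at h2
  have h3 : (-1) ^ m * (y - x m) = b m * d (m + 1) + d (m + 2) := by
    apply le_antisymm h1
    nlinarith
  rw [hx]
  rcases neg_one_pow_eq_or ℝ m with e | e <;> rw [e] at h3 ⊢ <;> linarith

end Expansion

/-- Greedy expansions with the same partial sum have the same digits. -/
lemma digits_eq_of_sum_eq {S : ℕ → ℕ} {ω ω' : ℕ → Bool}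
    (h : ∀ n, ∑ i ∈ Finset.range n, (ω i).toNat * S i < S n)
    (h' : ∀ n, ∑ i ∈ Finset.range n, (ω' i).toNat * S i < S n) (n : ℕ)
    (heq : ∑ i ∈ Finset.range n, (ω i).toNat * S i =
      ∑ i ∈ Finset.range n, (ω' i).toNat * S i) : ∀ i < n, ω i = ω' i := by
  induction n with
  | zero => intro i hi; omega
  | succ n ih =>
    rw [Finset.sum_range_succ, Finset.sum_range_succ] at heq
    have h1 := h n
    have h2 := h' n
    have hn : ω n = ω' n := by
      cases hω : ω n <;> cases hω' : ω' n <;> simp [hω, hω'] at heq ⊢ <;> omega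
    rw [hn] at heq
    intro i hi
    rcases Nat.lt_succ_iff_lt_or_eq.mp hi with hlt | rfl
    · exact ih (by omega) i hlt
    · exact hn

/-- If the weights on `[R, R + L)` are multiples of `c`, then so is the sum over this block. -/
lemma exists_digit {S : ℕ → ℕ} (ω : ℕ → Bool) {R c : ℕ} {L : ℕ}
    (hS : ∀ j < L, S (R + j) = (j + 1) * c) :
    ∃ b, ∑ i ∈ Finset.range (R + L), (ω i).toNat * S i =
      ∑ i ∈ Finset.range R, (ω i).toNat * S i + b * c := by
  refine ⟨∑ j ∈ Finset.range L, (ω (R + j)).toNat * (j + 1), ?_⟩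
  rw [Finset.sum_range_add, Finset.sum_mul]
  congr 1
  refine Finset.sum_congr rfl fun j hj => ?_
  rw [hS j (Finset.mem_range.mp hj)]
  ring

lemma exists_nsmul_of_add_mul_eq_int {y ρ : ℝ} {z : AddCircle (1 : ℝ)}
    (hz : (y : AddCircle (1 : ℝ)) = z) (n : ℕ) (t : ℤ) (h : y + n * ρ = t) :
    ∃ n : ℕ, z + n • (ρ : AddCircle (1 : ℝ)) = 0 := by
  refine ⟨n, ?_⟩
  rw [← hz, ← AddCircle.coe_nsmul, ← AddCircle.coe_add, nsmul_eq_mul, h,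
    AddCircle.coe_eq_zero_iff]
  exact ⟨t, by simp⟩

/-- Two distinct Ostrowski expansions (given by their partial sums `M` and `M'`) can represent the
same point of the circle only if this point is in the backward rotation orbit of `0`. -/
theorem exists_nsmul_of_ostrowski_collision {A Q P : ℕ → ℕ} (hA : ∀ k, 1 ≤ A k)
    (hQ : ∀ k, Q (k + 2) = A k * Q (k + 1) + Q k)
    (hP : ∀ k, P (k + 2) = A k * P (k + 1) + P k)
    (hQ0 : Q 0 = 0) (hQ1 : Q 1 = 1) (hP0 : P 0 = 1) (hP1 : P 1 = 0)
    {ρ : ℝ} (hρ : Irrational ρ) (hlim : Tendsto (fun k => (P k : ℝ) / Q k) atTop (𝓝 ρ))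
    {M M' : ℕ → ℕ} (hM0 : M 0 = 0) (hM0' : M' 0 = 0)
    (hMQ : ∀ k, M k < Q (k + 1)) (hMQ' : ∀ k, M' k < Q (k + 1))
    (hM : ∀ k, ∃ b, M (k + 1) = M k + b * Q (k + 1))
    (hM' : ∀ k, ∃ b, M' (k + 1) = M' k + b * Q (k + 1))
    {z : AddCircle (1 : ℝ)}
    (hz : Tendsto (fun k => ((M k * ρ : ℝ) : AddCircle (1 : ℝ))) atTop (𝓝 z))
    (hz' : Tendsto (fun k => ((M' k * ρ : ℝ) : AddCircle (1 : ℝ))) atTop (𝓝 z))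
    (hne : ∃ k, M k ≠ M' k) :
    ∃ n : ℕ, z + n • (ρ : AddCircle (1 : ℝ)) = 0 := by
  choose b hb using hM
  choose b' hb' using hM'
  have hQpos : ∀ k, 0 < Q (k + 1) := fun k => (Nat.zero_le _).trans_lt (hMQ k)
  have hQm : ∀ k, Q k ≤ Q (k + 1) := by
    intro k
    cases k with
    | zero => simp [hQ0]
    | succ k =>
      rw [hQ]
      nlinarith [hA k, hQpos k]
  obtain ⟨d, hd⟩ : ∃ d : ℕ → ℝ, ∀ k, d k = (-1) ^ (k + 1) * (Q k * ρ - P k) := ⟨_, fun _ => rfl⟩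
  have hdpos : ∀ k, 0 < d k := fun k => by
    rw [hd]
    exact alternating_sign hQpos hQm hQ hP hQ0 hP0 hρ hlim k
  have hdrec : ∀ k, d (k + 2) = d k - A k * d (k + 1) := fun k => by
    simp only [hd, hQ, hP]
    push_cast
    ring
  have hdQ : ∀ k, (-1) ^ k * d (k + 1) = Q (k + 1) * ρ - P (k + 1) := fun k => by
    rw [hd]
    rcases neg_one_pow_eq_or ℝ k with e | e <;> rw [pow_succ, pow_succ, e] <;> ring
  have partial_eq : ∀ {M b : ℕ → ℕ}, M 0 = 0 → (∀ k, M (k + 1) = M k + b k * Q (k + 1)) → ∀ k,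
      ∑ i ∈ Finset.range k, b i * ((-1) ^ i * d (i + 1)) =
        M k * ρ - ∑ i ∈ Finset.range k, (b i * P (i + 1) : ℕ) := by
    intro M b hM0 hb k
    induction k with
    | zero => simp [hM0]
    | succ k ih =>
      rw [Finset.sum_range_succ, ih, hdQ, hb, Finset.sum_range_succ]
      push_cast
      ring
  obtain ⟨x, hx⟩ : ∃ x : ℕ → ℝ,
      ∀ k, x k = ∑ i ∈ Finset.range k, b i * ((-1) ^ i * d (i + 1)) := ⟨_, fun _ => rfl⟩
  obtain ⟨x', hx'⟩ : ∃ x' : ℕ → ℝ,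
      ∀ k, x' k = ∑ i ∈ Finset.range k, b' i * ((-1) ^ i * d (i + 1)) := ⟨_, fun _ => rfl⟩
  have hxs : ∀ k, x (k + 1) = x k + b k * ((-1) ^ k * d (k + 1)) := fun k => by
    rw [hx, hx, Finset.sum_range_succ]
  have hxs' : ∀ k, x' (k + 1) = x' k + b' k * ((-1) ^ k * d (k + 1)) := fun k => by
    rw [hx', hx', Finset.sum_range_succ]
  have hxM : ∀ k, x k = M k * ρ - ∑ i ∈ Finset.range k, (b i * P (i + 1) : ℕ) := fun k => by
    rw [hx, partial_eq hM0 hb]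
  have hxM' : ∀ k, x' k = M' k * ρ - ∑ i ∈ Finset.range k, (b' i * P (i + 1) : ℕ) := fun k => by
    rw [hx', partial_eq hM0' hb']
  have coe_sub_nat : ∀ (t : ℝ) (n : ℕ), ((t - n : ℝ) : AddCircle (1 : ℝ)) = t := by
    intro t n
    rw [AddCircle.coe_sub, sub_eq_self, AddCircle.coe_eq_zero_iff]
    exact ⟨n, by simp⟩
  obtain ⟨y, hyz, hy⟩ := exists_lift_mem_cylinder hA hQm hQ hdpos hdrec hb hMQ hxs
    (z := z) (by simpa only [hxM, coe_sub_nat] using hz)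
  obtain ⟨y', hyz', hy'⟩ := exists_lift_mem_cylinder hA hQm hQ hdpos hdrec hb' hMQ' hxs'
    (z := z) (by simpa only [hxM', coe_sub_nat] using hz')
  have base : ∀ {M : ℕ → ℕ} {x : ℕ → ℝ} {y : ℝ}, x 0 = 0 → y ∈ cylinder d Q M x 0 →
      -ρ ≤ y ∧ y ≤ 1 - ρ := by
    intro M x y hx0 h
    have h1 := h.1
    have h2 := h.2
    have e0 : d 0 = 1 := by simp [hd, hQ0, hP0]
    have e1 : d 1 = ρ := by simp [hd, hQ1, hP1]
    simp only [hQ0, hx0, zero_add, e0, e1, pow_zero, one_mul, sub_zero, Nat.not_lt_zero,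
      if_false] at h1 h2
    exact ⟨h1, h2⟩
  obtain ⟨l, u⟩ := base (by simp [hx]) (hy 0)
  obtain ⟨l', u'⟩ := base (by simp [hx']) (hy' 0)
  obtain ⟨t, ht⟩ := (AddCircle.coe_eq_zero_iff (1 : ℝ) (x := y - y')).mp (by
    rw [AddCircle.coe_sub, hyz, hyz', sub_self])
  simp only [zsmul_eq_mul, mul_one] at ht
  rcases lt_trichotomy t 0 with hneg | rfl | hpos
  · have : (t : ℝ) ≤ -1 := by exact_mod_cast Int.le_sub_one_of_lt hneg
    exact exists_nsmul_of_add_mul_eq_int hyz 1 0 (by push_cast; linarith)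
  · have hyy : y' = y := by
      push_cast at ht
      linarith
    subst hyy
    classical
    obtain ⟨m, hm⟩ : ∃ m, Nat.find hne = m + 1 := by
      refine Nat.exists_eq_succ_of_ne_zero fun h0 => Nat.find_spec hne ?_
      rw [h0, hM0, hM0']
    have hMeq : ∀ i ≤ m, M i = M' i := fun i hi => by
      by_contra hcon
      have := Nat.find_min' hne hcon
      omega
    have hMne : M (m + 1) ≠ M' (m + 1) := hm ▸ Nat.find_spec hne
    have hbeq : ∀ i < m, b i = b' i := fun i hi => by
      have h1 := hb i
      rw [hMeq _ hi, hMeq i hi.le, hb' i] at h1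
      exact (Nat.eq_of_mul_eq_mul_right (hQpos i) (by omega)).symm
    have hxx : x m = x' m := by
      rw [hx, hx']
      exact Finset.sum_congr rfl fun i hi => by rw [hbeq i (Finset.mem_range.mp hi)]
    have finish : ∀ {M : ℕ → ℕ} {x : ℕ → ℝ} {c : ℕ}, M (m + 1) < Q (m + 2) →
        x (m + 1) = M (m + 1) * ρ - c → y' = x (m + 1) + (-1) ^ m * d (m + 2) →
        ∃ n : ℕ, z + n • (ρ : AddCircle (1 : ℝ)) = 0 := by
      intro M x c hlt hxc hend
      refine exists_nsmul_of_add_mul_eq_int hyz (Q (m + 2) - M (m + 1)) (P (m + 2) - c) ?_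
      have := hdQ (m + 1)
      rw [pow_succ] at this
      rw [hend, hxc, Nat.cast_sub hlt.le]
      push_cast
      linarith
    rcases lt_trichotomy (b m) (b' m) with hlt | heq | hgt
    · exact finish (hMQ _) (hxM _)
        (eq_endpoint_of_digit_lt hdpos hxs hb' hxs' (hy _) (hy' _) hxx hlt)
    · exact absurd (by rw [hb, hb', heq, hMeq m le_rfl]) hMne
    · exact finish (hMQ' _) (hxM' _)
        (eq_endpoint_of_digit_lt hdpos hxs' hb hxs (hy' _) (hy _) hxx.symm hgt)
  · have : (1 : ℝ) ≤ t := by exact_mod_cast hpos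
    exact exists_nsmul_of_add_mul_eq_int hyz' 1 0 (by push_cast; linarith)


/-- With the rotation-like data `a, p, q, r, S, ρ` as before,
`Ω ⊆ {0,1}^ℕ` with the product topology and `Π_ρ : Ω → ℝ/ℤ` the continuous map
`ω ↦ lim_N Σ_{j=0}^{N} ω j * S j * ρ (mod 1)`: if `ω ≠ ω'` in `Ω` satisfy
`Π_ρ ω = Π_ρ ω'`, then there exists `n ∈ ℕ` with `Π_ρ ω + n • ρ = 0` in `ℝ/ℤ`; that is,
`Π_ρ` is injective except over points of the circle in the backward rotation orbit of
`0`. -/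
theorem stmt_8 (a : ℕ → ℕ) (ha : ∀ k, 1 ≤ k → 1 ≤ a k)
    (q : ℕ → ℕ) (hq0 : q 0 = 1) (hq1 : q 1 = a 1)
    (hq : ∀ k, 1 ≤ k → q (k + 1) = a (k + 1) * q k + q (k - 1))
    (p : ℕ → ℕ) (hp0 : p 0 = 0) (hp1 : p 1 = 1)
    (hp : ∀ k, 1 ≤ k → p (k + 1) = a (k + 1) * p k + p (k - 1))
    (ρ : ℝ) (hρirr : Irrational ρ) (hρmem : ρ ∈ Set.Ioo (0 : ℝ) 1)
    (hρlim : Filter.Tendsto (fun k => (p k : ℝ) / (q k : ℝ)) Filter.atTop (nhds ρ))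
    (r : ℕ → ℕ) (hr1 : r 1 = q 1 - 1)
    (hr : ∀ k, 1 ≤ k → r (k + 1) = r k + a (k + 1))
    (S : ℕ → ℕ) (hSlow : ∀ j, j ≤ r 1 → S j = j + 1)
    (hShigh : ∀ k, 1 ≤ k → ∀ j, j < a (k + 1) → S (r k + j) = (j + 1) * q k)
    (Pi : {ω : ℕ → Bool //
        ∀ j, ∑ i ∈ Finset.range (j + 1), (ω i).toNat * S i < S (j + 1)} → AddCircle (1 : ℝ))
    (hPicont : Continuous Pi)
    (hPi : ∀ ω, Filter.Tendsto
        (fun N => ((↑(∑ j ∈ Finset.range (N + 1),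
            ((ω.val j).toNat : ℝ) * (S j : ℝ) * ρ)) : AddCircle (1 : ℝ)))
        Filter.atTop (nhds (Pi ω))) :
    ∀ ω ω', ω ≠ ω' → Pi ω = Pi ω' →
      ∃ n : ℕ, Pi ω + n • ((ρ : ℝ) : AddCircle (1 : ℝ)) = 0 := by
  intro ω ω' hne heq
  have hgreedy : ∀ ω : {ω : ℕ → Bool //
      ∀ j, ∑ i ∈ Finset.range (j + 1), (ω i).toNat * S i < S (j + 1)}, ∀ n,
      ∑ i ∈ Finset.range n, (ω.val i).toNat * S i < S n := by
    intro ω n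
    cases n with
    | zero => simp [hSlow 0 (Nat.zero_le _)]
    | succ n => exact ω.2 n
  have ha1 := ha 1 le_rfl
  -- the block of indices attached to `q k` is `[R k, R k + L k)`
  obtain ⟨R, hR0, hR⟩ : ∃ R : ℕ → ℕ, R 0 = 0 ∧ ∀ k, 1 ≤ k → R k = r k :=
    ⟨fun k => if k = 0 then 0 else r k, rfl, fun k hk => if_neg (by omega)⟩
  obtain ⟨L, hL0, hL⟩ : ∃ L : ℕ → ℕ, L 0 = a 1 - 1 ∧ ∀ k, 1 ≤ k → L k = a (k + 1) :=
    ⟨fun k => if k = 0 then a 1 - 1 else a (k + 1), rfl, fun k hk => if_neg (by omega)⟩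
  have hRL : ∀ k, R (k + 1) = R k + L k := by
    intro k
    rcases Nat.eq_zero_or_pos k with rfl | hk
    · rw [hR0, hL0, zero_add, hR 1 le_rfl, hr1, hq1, zero_add]
    · rw [hR _ (by omega), hR k hk, hL k hk, hr k hk]
  have hSblock : ∀ k, ∀ j < L k, S (R k + j) = (j + 1) * q k := by
    intro k j hj
    rcases Nat.eq_zero_or_pos k with rfl | hk
    · rw [hL0] at hj
      rw [hR0, zero_add, hq0, mul_one, hSlow j (by omega)]
    · rw [hR k hk]
      exact hShigh k hk j (hL k hk ▸ hj)
  have hSR : ∀ k, S (R k) = q k := by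
    intro k
    rcases Nat.eq_zero_or_pos k with rfl | hk
    · rw [hR0, hSlow 0 (Nat.zero_le _), hq0]
    · simpa using hSblock k 0 (by rw [hL k hk]; exact ha _ (by omega))
  have hRge : ∀ k, k ≤ R (k + 1) := by
    intro k
    induction k with
    | zero => exact Nat.zero_le _
    | succ k ih =>
      rw [hRL, hL _ (by omega)]
      have := ha (k + 1 + 1) (by omega)
      omega
  have hRtop : Tendsto R atTop atTop :=
    (tendsto_add_atTop_iff_nat 1).mp (tendsto_atTop_mono hRge tendsto_id)
  have hconv : ∀ ω, Tendsto (fun k => (((∑ i ∈ Finset.range (R k), (ω.val i).toNat * S i : ℕ) * ρ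
      : ℝ) : AddCircle (1 : ℝ))) atTop (𝓝 (Pi ω)) := by
    intro ω
    refine Tendsto.comp (g := fun n => (((∑ i ∈ Finset.range n, (ω.val i).toNat * S i : ℕ) * ρ
      : ℝ) : AddCircle (1 : ℝ))) ((tendsto_add_atTop_iff_nat 1).mp ?_) hRtop
    refine (hPi ω).congr fun N => ?_
    rw [← Finset.sum_mul]
    push_cast
    rfl
  obtain ⟨Q, hQ0, hQs⟩ : ∃ Q : ℕ → ℕ, Q 0 = 0 ∧ ∀ k, Q (k + 1) = q k :=
    ⟨fun k => Nat.casesOn k 0 q, rfl, fun _ => rfl⟩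
  obtain ⟨P, hP0, hPs⟩ : ∃ P : ℕ → ℕ, P 0 = 1 ∧ ∀ k, P (k + 1) = p k :=
    ⟨fun k => Nat.casesOn k 1 p, rfl, fun _ => rfl⟩
  refine exists_nsmul_of_ostrowski_collision (A := fun k => a (k + 1)) (Q := Q) (P := P)
    (M := fun k => ∑ i ∈ Finset.range (R k), (ω.val i).toNat * S i)
    (M' := fun k => ∑ i ∈ Finset.range (R k), (ω'.val i).toNat * S i)
    (fun k => ha _ (by omega)) ?_ ?_ hQ0 ((hQs 0).trans hq0) hP0 ((hPs 0).trans hp0) hρirr ?_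
    (by simp [hR0]) (by simp [hR0]) ?_ ?_ ?_ ?_ (hconv ω) (heq ▸ hconv ω') ?_
  · intro k
    cases k with
    | zero => simp [hQs, hQ0, hq0, hq1]
    | succ k => simpa [hQs] using hq (k + 1) (by omega)
  · intro k
    cases k with
    | zero => simp [hPs, hP0, hp0, hp1]
    | succ k => simpa [hPs] using hp (k + 1) (by omega)
  · refine (tendsto_add_atTop_iff_nat 1).mp ?_
    simpa only [hPs, hQs] using hρlim
  · intro k
    rw [hQs, ← hSR]
    exact hgreedy ω _
  · intro k
    rw [hQs, ← hSR]
    exact hgreedy ω' _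
  · intro k
    simp only [hQs, hRL]
    exact exists_digit ω.val (hSblock k)
  · intro k
    simp only [hQs, hRL]
    exact exists_digit ω'.val (hSblock k)
  · by_contra! hcon
    refine hne (Subtype.ext (funext fun i => ?_))
    exact digits_eq_of_sum_eq (hgreedy ω) (hgreedy ω') (R (i + 2)) (hcon (i + 2)) i
      (Nat.lt_of_succ_le (hRge (i + 1)))
end

section
/- For every c ∈ ℂ: if 0 ∈ K_c (the critical orbit is bounded) then the filled Julia set K_c is connected, and if 0 ∉ K_c then K_c is totally disconnected. -/
/-- The filled Julia set of `f_c(z) = z² + c`: points with bounded forward orbit. -/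
def filledJulia (c : ℂ) : Set ℂ :=
  {z : ℂ | Bornology.IsBounded (Set.range fun n => (fun w : ℂ => w ^ 2 + c)^[n] z)}

open Set Filter Topology Metric

/-- The quadratic map `z ↦ z² + c`. -/
def quadMap (c : ℂ) : ℂ → ℂ := fun w => w ^ 2 + c

theorem differentiable_quadMap (c : ℂ) : Differentiable ℂ (quadMap c) := by
  unfold quadMap
  fun_prop

theorem differentiable_iterate_quadMap (c : ℂ) (n : ℕ) : Differentiable ℂ (quadMap c)^[n] :=
  (differentiable_quadMap c).iterate n

theorem continuous_iterate_quadMap (c : ℂ) (n : ℕ) : Continuous (quadMap c)^[n] :=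
  (differentiable_iterate_quadMap c n).continuous

theorem mem_filledJulia_iff {c z : ℂ} :
    z ∈ filledJulia c ↔ Bornology.IsBounded (range fun n => (quadMap c)^[n] z) := Iff.rfl

theorem quadMap_mem_filledJulia {c z : ℂ} (hz : z ∈ filledJulia c) :
    quadMap c z ∈ filledJulia c := by
  rw [mem_filledJulia_iff] at hz ⊢
  refine hz.subset ?_
  rintro _ ⟨n, rfl⟩
  exact ⟨n + 1, by simp⟩

theorem iterate_quadMap_mem_filledJulia {c z : ℂ} (hz : z ∈ filledJulia c) (n : ℕ) :
    (quadMap c)^[n] z ∈ filledJulia c := by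
  induction n with
  | zero => exact hz
  | succ n ih =>
    rw [Function.iterate_succ_apply']
    exact quadMap_mem_filledJulia ih

/-- The closed disk of radius `‖c‖ + 2` traps every bounded orbit of `quadMap c`. -/
noncomputable def escapeRadius (c : ℂ) : ℝ := ‖c‖ + 2

theorem escapeRadius_pos (c : ℂ) : 0 < escapeRadius c := by
  unfold escapeRadius
  positivity

theorem norm_add_one_le_norm_quadMap {c z : ℂ} (hz : escapeRadius c ≤ ‖z‖) :
    ‖z‖ + 1 ≤ ‖quadMap c z‖ := by
  have h : ‖z‖ ^ 2 ≤ ‖quadMap c z‖ + ‖c‖ := by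
    have := norm_sub_le (quadMap c z) c
    simpa [quadMap] using this
  unfold escapeRadius at hz
  nlinarith [norm_nonneg c, norm_nonneg z]

theorem norm_lt_escapeRadius_of_norm_quadMap_le {c z : ℂ}
    (hz : ‖quadMap c z‖ ≤ escapeRadius c) : ‖z‖ < escapeRadius c := by
  by_contra! h
  linarith [norm_add_one_le_norm_quadMap h]

theorem norm_add_natCast_le_norm_iterate_quadMap {c z : ℂ} (hz : escapeRadius c ≤ ‖z‖) (n : ℕ) :
    ‖z‖ + n ≤ ‖(quadMap c)^[n] z‖ := by
  induction n with
  | zero => simp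
  | succ n ih =>
    rw [Function.iterate_succ_apply']
    have hn : (0 : ℝ) ≤ n := n.cast_nonneg
    have := norm_add_one_le_norm_quadMap (c := c) (z := (quadMap c)^[n] z) (by linarith)
    push_cast
    linarith

theorem norm_le_escapeRadius_of_mem_filledJulia {c z : ℂ} (hz : z ∈ filledJulia c) :
    ‖z‖ ≤ escapeRadius c := by
  by_contra! h
  obtain ⟨M, hM⟩ := (mem_filledJulia_iff.1 hz).exists_norm_le
  obtain ⟨n, hn⟩ := exists_nat_gt M
  have h₁ := hM _ ⟨n, rfl⟩
  have h₂ := norm_add_natCast_le_norm_iterate_quadMap h.le n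
  have h₃ := norm_nonneg z
  simp only at h₁
  linarith

/-- The points whose `n`-th iterate lies in the closed disk of radius `escapeRadius c`. -/
def trapped (c : ℂ) (n : ℕ) : Set ℂ := {z | ‖(quadMap c)^[n] z‖ ≤ escapeRadius c}

/-- The points whose `n`-th iterate lies in the open disk of radius `escapeRadius c`. -/
def openTrapped (c : ℂ) (n : ℕ) : Set ℂ := {z | ‖(quadMap c)^[n] z‖ < escapeRadius c}

theorem isClosed_trapped (c : ℂ) (n : ℕ) : IsClosed (trapped c n) :=
  isClosed_le (continuous_iterate_quadMap c n).norm continuous_const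

theorem isOpen_openTrapped (c : ℂ) (n : ℕ) : IsOpen (openTrapped c n) :=
  isOpen_lt (continuous_iterate_quadMap c n).norm continuous_const

theorem openTrapped_subset_trapped (c : ℂ) (n : ℕ) : openTrapped c n ⊆ trapped c n :=
  fun z (hz : ‖(quadMap c)^[n] z‖ < escapeRadius c) => hz.le

theorem trapped_succ_subset_openTrapped (c : ℂ) (n : ℕ) :
    trapped c (n + 1) ⊆ openTrapped c n := by
  intro z hz
  refine norm_lt_escapeRadius_of_norm_quadMap_le ?_
  rwa [← Function.iterate_succ_apply' (quadMap c)]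

theorem trapped_antitone (c : ℂ) : Antitone (trapped c) :=
  antitone_nat_of_succ_le fun n =>
    (trapped_succ_subset_openTrapped c n).trans (openTrapped_subset_trapped c n)

theorem trapped_succ (c : ℂ) (n : ℕ) : trapped c (n + 1) = quadMap c ⁻¹' trapped c n := rfl

theorem trapped_zero (c : ℂ) : trapped c 0 = closedBall 0 (escapeRadius c) := by
  ext z
  simp [trapped]

theorem norm_le_of_mem_trapped {c z : ℂ} {n : ℕ} (hz : z ∈ trapped c n) :
    ‖z‖ ≤ escapeRadius c :=
  trapped_antitone c n.zero_le hz

theorem isCompact_trapped (c : ℂ) (n : ℕ) : IsCompact (trapped c n) :=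
  (isCompact_closedBall (0 : ℂ) (escapeRadius c)).of_isClosed_subset (isClosed_trapped c n)
    fun z hz => by simpa using norm_le_of_mem_trapped hz

theorem filledJulia_eq_iInter_trapped (c : ℂ) : filledJulia c = ⋂ n, trapped c n := by
  refine Subset.antisymm (subset_iInter fun n z hz => ?_) fun z hz => ?_
  · exact norm_le_escapeRadius_of_mem_filledJulia (iterate_quadMap_mem_filledJulia hz n)
  · rw [mem_filledJulia_iff, isBounded_iff_forall_norm_le]
    refine ⟨escapeRadius c, ?_⟩
    rintro _ ⟨n, rfl⟩
    exact mem_iInter.1 hz n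

theorem filledJulia_subset_trapped (c : ℂ) (n : ℕ) : filledJulia c ⊆ trapped c n :=
  filledJulia_eq_iInter_trapped c ▸ iInter_subset _ n

theorem isCompact_filledJulia (c : ℂ) : IsCompact (filledJulia c) := by
  rw [filledJulia_eq_iInter_trapped]
  exact (isCompact_trapped c 0).of_isClosed_subset (isClosed_iInter (isClosed_trapped c))
    (iInter_subset _ 0)

theorem zero_mem_filledJulia_of_critical_value_mem {c : ℂ} (h : c ∈ filledJulia c) :
    (0 : ℂ) ∈ filledJulia c := by
  rw [filledJulia_eq_iInter_trapped] at h ⊢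
  have hs : (0 : ℂ) ∈ ⋂ n, trapped c (n + 1) := by
    simpa [trapped_succ, quadMap] using h
  refine mem_iInter.2 fun n => ?_
  exact trapped_antitone c n.le_succ (mem_iInter.1 hs n)

/-! ### Connectedness -/

/-- The intersection of a decreasing sequence of compact preconnected sets is preconnected. -/
theorem isPreconnected_iInter_of_antitone {X : Type*} [TopologicalSpace X] [T2Space X]
    {D : ℕ → Set X} (hanti : Antitone D) (hcomp : ∀ n, IsCompact (D n))
    (hconn : ∀ n, IsPreconnected (D n)) : IsPreconnected (⋂ n, D n) := by
  have hK : IsCompact (⋂ n, D n) :=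
    (hcomp 0).of_isClosed_subset (isClosed_iInter fun n => (hcomp n).isClosed) (iInter_subset _ 0)
  rw [isPreconnected_closed_iff]
  intro A B hA hB hcov hKA hKB
  by_contra hne
  have hdisj : Disjoint ((⋂ n, D n) ∩ A) ((⋂ n, D n) ∩ B) :=
    disjoint_left.2 fun x hx hx' => hne ⟨x, hx.1, hx.2, hx'.2⟩
  obtain ⟨U, V, hU, hV, hAU, hBV, hUV⟩ :=
    SeparatedNhds.of_isCompact_isCompact (hK.inter_right hA) (hK.inter_right hB) hdisj
  have hsub : (⋂ n, D n) ⊆ U ∪ V := fun x hx =>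
    (hcov hx).imp (fun h => hAU ⟨hx, h⟩) fun h => hBV ⟨hx, h⟩
  obtain ⟨n, hn⟩ := exists_subset_nhds_of_isCompact' (directed_of_isDirected_le hanti)
    hcomp (fun n => (hcomp n).isClosed) fun x hx => (hU.union hV).mem_nhds (hsub hx)
  obtain ⟨x, hx⟩ := hKA
  obtain ⟨y, hy⟩ := hKB
  obtain ⟨w, -, hw⟩ := hconn n U V hU hV hn ⟨x, mem_iInter.1 hx.1 n, hAU hx⟩
    ⟨y, mem_iInter.1 hy.1 n, hBV hy⟩
  exact disjoint_left.1 hUV hw.1 hw.2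

theorem quadMap_surjective (c : ℂ) : Function.Surjective (quadMap c) := fun w => by
  obtain ⟨z, hz⟩ := IsAlgClosed.exists_pow_nat_eq (w - c) two_pos
  exact ⟨z, by simp [quadMap, hz]⟩

theorem quadMap_eq_quadMap_iff {c z w : ℂ} : quadMap c z = quadMap c w ↔ z = w ∨ z = -w := by
  simp [quadMap, sq_eq_sq_iff_eq_or_eq_neg]

theorem quadMap_neg (c z : ℂ) : quadMap c (-z) = quadMap c z := by simp [quadMap]

/-- A compact connected set containing the critical value has connected preimage. -/
theorem IsPreconnected.preimage_quadMap {c : ℂ} {E : Set ℂ} (hE : IsPreconnected E)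
    (hcomp : IsCompact (quadMap c ⁻¹' E)) (hc : c ∈ E) : IsPreconnected (quadMap c ⁻¹' E) := by
  have hcont : Continuous (quadMap c) := (differentiable_quadMap c).continuous
  rw [isPreconnected_closed_iff]
  have key : ∀ A B : Set ℂ, IsClosed A → IsClosed B → quadMap c ⁻¹' E ⊆ A ∪ B →
      (quadMap c ⁻¹' E ∩ B).Nonempty → (0 : ℂ) ∈ A →
      (quadMap c ⁻¹' E ∩ (A ∩ B)).Nonempty := by
    intro A B hA hB hcov hEB h0
    by_contra hne
    have hS : IsClosed (quadMap c '' (quadMap c ⁻¹' E ∩ (A ∩ Neg.neg ⁻¹' A))) :=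
      ((hcomp.inter_right (hA.inter (hA.preimage continuous_neg))).image hcont).isClosed
    have hT : IsClosed (quadMap c '' (quadMap c ⁻¹' E ∩ B)) :=
      ((hcomp.inter_right hB).image hcont).isClosed
    obtain ⟨b, hbE, hbB⟩ := hEB
    obtain ⟨w, hwE, ⟨z, ⟨hzE, hzA, hzA'⟩, hzw⟩, ⟨y, ⟨hyE, hyB⟩, hyw⟩⟩ :=
      isPreconnected_closed_iff.1 hE _ _ hS hT (by
        intro w hw
        obtain ⟨z, rfl⟩ := quadMap_surjective c w
        have hz' : -z ∈ quadMap c ⁻¹' E := by rwa [mem_preimage, quadMap_neg]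
        rcases hcov hw with h | h
        · rcases hcov hz' with h' | h'
          · exact Or.inl ⟨z, ⟨hw, h, h'⟩, rfl⟩
          · exact Or.inr ⟨-z, ⟨hz', h'⟩, quadMap_neg c z⟩
        · exact Or.inr ⟨z, ⟨hw, h⟩, rfl⟩)
        ⟨c, hc, 0, ⟨by simpa [quadMap] using hc, h0, by simpa using h0⟩, by simp [quadMap]⟩
        ⟨quadMap c b, hbE, b, ⟨hbE, hbB⟩, rfl⟩
    rcases quadMap_eq_quadMap_iff.1 (hyw.trans hzw.symm) with rfl | rfl
    · exact hne ⟨y, hyE, hzA, hyB⟩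
    · exact hne ⟨-z, hyE, hzA', hyB⟩
  intro A B hA hB hcov hEA hEB
  have h0 : (0 : ℂ) ∈ quadMap c ⁻¹' E := by simpa [quadMap] using hc
  rcases hcov h0 with h | h
  · exact key A B hA hB hcov hEB h
  · rw [inter_comm A B]
    exact key B A hB hA (by rwa [union_comm]) hEA h

theorem isPreconnected_filledJulia {c : ℂ} (hc : c ∈ filledJulia c) :
    IsPreconnected (filledJulia c) := by
  rw [filledJulia_eq_iInter_trapped]
  refine isPreconnected_iInter_of_antitone (trapped_antitone c) (isCompact_trapped c) fun n => ?_
  induction n with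
  | zero =>
    rw [trapped_zero]
    exact (convex_closedBall _ _).isPreconnected
  | succ n ih =>
    exact ih.preimage_quadMap (isCompact_trapped c (n + 1)) (filledJulia_subset_trapped c n hc)

/-! ### Total disconnectedness -/

/-- `z ↦ z - a` has a holomorphic square root on `U`. -/
def HasSqrtSub (U : Set ℂ) (a : ℂ) : Prop :=
  ∃ s : ℂ → ℂ, DifferentiableOn ℂ s U ∧ ∀ z ∈ U, s z ^ 2 = z - a

theorem exists_sqrt_one_add_of_norm_lt_one {U : Set ℂ} {h : ℂ → ℂ}
    (hd : DifferentiableOn ℂ h U) (hh : ∀ z ∈ U, ‖h z‖ < 1) :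
    ∃ s : ℂ → ℂ, DifferentiableOn ℂ s U ∧ ∀ z ∈ U, s z ^ 2 = 1 + h z := by
  have hslit : ∀ z ∈ U, 1 + h z ∈ Complex.slitPlane := fun z hz =>
    Complex.mem_slitPlane_of_norm_lt_one (hh z hz)
  refine ⟨fun z => Complex.exp (Complex.log (1 + h z) / 2), ?_, fun z hz => ?_⟩
  · exact (((hd.const_add 1).clog hslit).div_const 2).cexp
  · simp only [← Complex.exp_nat_mul]
    rw [Nat.cast_ofNat, mul_div_cancel₀ _ two_ne_zero,
      Complex.exp_log (Complex.slitPlane_ne_zero (hslit z hz))]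

theorem HasSqrtSub.of_norm_sub_lt {U : Set ℂ} {a b : ℂ} (ha : HasSqrtSub U a)
    (hab : ∀ z ∈ U, ‖a - b‖ < ‖z - a‖) : HasSqrtSub U b := by
  obtain ⟨s, hs, hs'⟩ := ha
  have hne : ∀ z ∈ U, z - a ≠ 0 := fun z hz =>
    norm_pos_iff.1 ((norm_nonneg _).trans_lt (hab z hz))
  obtain ⟨t, ht, ht'⟩ := exists_sqrt_one_add_of_norm_lt_one (U := U)
    (h := fun z => (a - b) / (z - a))
    ((differentiableOn_const _).div (differentiableOn_id.sub_const a) hne) fun z hz => by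
      rw [norm_div, div_lt_one (norm_pos_iff.2 (hne z hz))]
      exact hab z hz
  refine ⟨fun z => s z * t z, hs.mul ht, fun z hz => ?_⟩
  have := hne z hz
  rw [mul_pow, hs' z hz, ht' z hz]
  field_simp
  ring

theorem hasSqrtSub_of_norm_lt {U : Set ℂ} {a : ℂ} (ha : ∀ z ∈ U, ‖z‖ < ‖a‖) :
    HasSqrtSub U a := by
  by_cases ha0 : a = 0
  · exact ⟨id, differentiableOn_id, fun z hz => absurd (ha z hz) (by simp [ha0])⟩
  obtain ⟨r, hr⟩ := IsAlgClosed.exists_pow_nat_eq (-a) two_pos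
  obtain ⟨t, ht, ht'⟩ := exists_sqrt_one_add_of_norm_lt_one (U := U)
    (h := fun z => -z / a) (differentiableOn_id.neg.div_const a) fun z hz => by
      rw [norm_div, norm_neg, div_lt_one (norm_pos_iff.2 ha0)]
      exact ha z hz
  refine ⟨fun z => r * t z, ht.const_mul r, fun z hz => ?_⟩
  rw [mul_pow, hr, ht' z hz]
  field_simp
  ring

/-- Off a trapped set, every `z - a` has a holomorphic square root on its interior part: by the
maximum principle the complement of a trapped set has no bounded component. -/
theorem hasSqrtSub_openTrapped {c a : ℂ} {n : ℕ} (ha : a ∉ trapped c n) :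
    HasSqrtSub (openTrapped c n) a := by
  by_contra hcon
  set T : Set ℂ := {a | a ∉ trapped c n ∧ ¬ HasSqrtSub (openTrapped c n) a}
  have hsep : ∀ a ∉ trapped c n, ∃ r > 0, ∀ b ∈ ball a r, b ∉ trapped c n ∧
      (HasSqrtSub (openTrapped c n) a ↔ HasSqrtSub (openTrapped c n) b) := by
    intro a ha
    obtain ⟨ε, hε, hball⟩ := Metric.isOpen_iff.1 (isClosed_trapped c n).isOpen_compl a ha
    refine ⟨ε / 2, half_pos hε, fun b hb => ?_⟩
    have hb' : ‖a - b‖ < ε / 2 := by rwa [mem_ball', dist_eq_norm] at hb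
    have hfar : ∀ z ∈ openTrapped c n, ε ≤ ‖z - a‖ := fun z hz => by
      by_contra! h
      exact hball (by rwa [mem_ball, dist_eq_norm]) (openTrapped_subset_trapped c n hz)
    refine ⟨hball (ball_subset_ball (half_le_self hε.le) hb), fun h => ?_, fun h => ?_⟩
    · exact h.of_norm_sub_lt fun z hz => by linarith [hfar z hz]
    · refine h.of_norm_sub_lt fun z hz => ?_
      have := norm_sub_le_norm_sub_add_norm_sub z b a
      rw [norm_sub_rev b a] at this ⊢
      linarith [hfar z hz]
  have hbdd : Bornology.IsBounded T := by
    refine isBounded_iff_forall_norm_le.2 ⟨escapeRadius c, fun b hb => ?_⟩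
    by_contra! h
    exact hb.2 (hasSqrtSub_of_norm_lt fun z hz =>
      (norm_le_of_mem_trapped (openTrapped_subset_trapped c n hz)).trans_lt h)
  have hfront : frontier T ⊆ trapped c n := by
    intro b hb
    by_contra hbE
    obtain ⟨r, hr, hball⟩ := hsep b hbE
    by_cases hbs : HasSqrtSub (openTrapped c n) b
    · obtain ⟨x, hx, hxT⟩ := mem_closure_iff.1 hb.1 _ isOpen_ball (mem_ball_self hr)
      exact hxT.2 ((hball x hx).2.1 hbs)
    · refine hb.2 (mem_interior.2 ⟨ball b r, fun x hx => ?_, isOpen_ball, mem_ball_self hr⟩)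
      exact ⟨(hball x hx).1, fun h => hbs ((hball x hx).2.2 h)⟩
  exact ha (Complex.norm_le_of_forall_mem_frontier_norm_le hbdd
    (differentiable_iterate_quadMap c n).diffContOnCl (fun z hz => hfront hz)
    (subset_closure ⟨ha, hcon⟩))

/-- Composite inverse branches: on a preconnected subset `C` of the filled Julia set, `f^n` is
inverted by a holomorphic self-map `G` of `U` which, at each point of `U`, admits a holomorphic
self-map of `U` with the same value and a derivative `(1 + t) ^ n` times larger. -/
theorem exists_inverse_branch_iterate {c : ℂ} {U : Set ℂ} {g : ℂ → ℂ} {t : ℝ}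
    (hKU : filledJulia c ⊆ U) (hUo : IsOpen U) (hg : DifferentiableOn ℂ g U)
    (hgsq : ∀ z ∈ U, g z ^ 2 = z - c)
    (hmaps : ∀ σ : ℂ, σ = 1 ∨ σ = -1 → ∀ x ∈ U, ∀ z ∈ U,
      σ * g z + t * (σ * g z - σ * g x) ∈ U)
    (h0 : (0 : ℂ) ∉ filledJulia c) (n : ℕ) :
    ∀ C ⊆ filledJulia c, IsPreconnected C → ∃ G : ℂ → ℂ, DifferentiableOn ℂ G U ∧
      MapsTo G U U ∧ (∀ z ∈ C, G ((quadMap c)^[n] z) = z) ∧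
      ∀ x ∈ U, ∃ H : ℂ → ℂ, DifferentiableOn ℂ H U ∧ MapsTo H U U ∧ H x = G x ∧
        deriv H x = (1 + t) ^ n * deriv G x := by
  induction n with
  | zero =>
    intro C _ _
    exact ⟨id, differentiableOn_id, mapsTo_id U, fun z _ => rfl, fun x _ =>
      ⟨id, differentiableOn_id, mapsTo_id U, rfl, by simp⟩⟩
  | succ n ih =>
    intro C hCK hC
    have hcont : Continuous (quadMap c) := (differentiable_quadMap c).continuous
    have hfC : quadMap c '' C ⊆ filledJulia c := by
      rintro _ ⟨z, hz, rfl⟩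
      exact quadMap_mem_filledJulia (hCK hz)
    obtain ⟨G, hGd, hGm, hGi, hGH⟩ := ih _ hfC (hC.image _ hcont.continuousOn)
    obtain ⟨σ, hσ, hσg⟩ : ∃ σ : ℂ, (σ = 1 ∨ σ = -1) ∧ ∀ z ∈ C, σ * g (quadMap c z) = z := by
      have hfU : MapsTo (quadMap c) C U := fun z hz =>
        hKU (quadMap_mem_filledJulia (hCK hz))
      rcases hC.eq_or_eq_neg_of_sq_eq (f := fun z => g (quadMap c z)) (g := id)
        (hg.continuousOn.comp hcont.continuousOn hfU) continuousOn_id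
        (fun z hz => by
          simp only [Pi.pow_apply, id]
          rw [hgsq _ (hfU hz)]
          simp [quadMap])
        (fun {z} hz hz0 => h0 (by rw [id] at hz0; exact hz0 ▸ hCK hz)) with h | h
      · exact ⟨1, Or.inl rfl, fun z hz => by simpa using h hz⟩
      · exact ⟨-1, Or.inr rfl, fun z hz => by
          have := h hz
          simp only [Pi.neg_apply, id] at this
          rw [this]
          ring⟩
    have hσU : MapsTo (fun z => σ * g z) U U := fun z hz => by
      simpa using hmaps σ hσ z hz z hz
    refine ⟨fun z => σ * g (G z), (hg.comp hGd hGm).const_mul σ, fun z hz => hσU (hGm hz),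
      fun z hz => ?_, fun x hx => ?_⟩
    · change σ * g (G ((quadMap c)^[n] (quadMap c z))) = z
      rw [hGi _ ⟨z, hz, rfl⟩, hσg z hz]
    · obtain ⟨H, hHd, hHm, hHx, hH'⟩ := hGH x hx
      refine ⟨fun z => σ * g (H z) + t * (σ * g (H z) - σ * g (G x)), ?_, fun z hz =>
        hmaps σ hσ _ (hGm hx) _ (hHm hz), by simp [hHx], ?_⟩
      · have := (hg.comp hHd hHm).const_mul σ
        exact this.add ((this.sub_const _).const_mul _)
      · have hgx : HasDerivAt g (deriv g (G x)) (G x) :=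
          (hg.differentiableAt (hUo.mem_nhds (hGm hx))).hasDerivAt
        have hGx : HasDerivAt G (deriv G x) x :=
          (hGd.differentiableAt (hUo.mem_nhds hx)).hasDerivAt
        have hHx' : HasDerivAt H (deriv H x) x :=
          (hHd.differentiableAt (hUo.mem_nhds hx)).hasDerivAt
        have h₁ : HasDerivAt (fun z => σ * g (G z)) (σ * (deriv g (G x) * deriv G x)) x :=
          (hgx.comp x hGx).const_mul σ
        have h₂ : HasDerivAt (fun z => σ * g (H z)) (σ * (deriv g (G x) * deriv H x)) x :=
          ((hHx ▸ hgx : HasDerivAt g (deriv g (G x)) (H x)).comp x hHx').const_mul σ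
        have h₃ : HasDerivAt (fun z => σ * g (H z) + t * (σ * g (H z) - σ * g (G x)))
            (σ * (deriv g (G x) * deriv H x) + t * (σ * (deriv g (G x) * deriv H x))) x :=
          h₂.add ((h₂.sub_const (σ * g (G x))).const_mul (t : ℂ))
        rw [h₁.deriv, h₃.deriv, hH']
        ring

/-- The distance between two points of a preconnected set covered by `N` sets of diameter at most
`d` is at most `N * d`. -/
theorem IsPreconnected.dist_le_card_mul {X ι : Type*} [PseudoMetricSpace X] {C : Set X}
    (hC : IsPreconnected C) {s : Finset ι} {S : ι → Set X} {d : ℝ} (hd : 0 ≤ d)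
    (hcov : C ⊆ ⋃ i ∈ s, S i) (hS : ∀ i ∈ s, ∀ x ∈ S i, ∀ y ∈ S i, dist x y ≤ d)
    {x y : X} (hx : x ∈ C) (hy : y ∈ C) : dist x y ≤ s.card * d := by
  have hIcc : Icc 0 (dist x y) ⊆ ⋃ i ∈ s, (dist x) '' S i := by
    have hsub := (hC.image (dist x) (by fun_prop)).Icc_subset ⟨x, hx, dist_self x⟩ ⟨y, hy, rfl⟩
    rw [← image_iUnion₂]
    exact hsub.trans (image_mono hcov)
  have hvol : ∀ i ∈ s, MeasureTheory.volume (dist x '' S i) ≤ ENNReal.ofReal d := by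
    intro i hi
    refine (Real.volume_le_diam _).trans (Metric.ediam_le_of_forall_dist_le ?_)
    rintro _ ⟨u, hu, rfl⟩ _ ⟨v, hv, rfl⟩
    rw [dist_comm x u, dist_comm x v]
    exact (dist_dist_dist_le_left u v x).trans (hS i hi u hu v hv)
  have h : ENNReal.ofReal (dist x y) ≤ ENNReal.ofReal (s.card * d) := by
    calc ENNReal.ofReal (dist x y) = MeasureTheory.volume (Icc 0 (dist x y)) := by simp
      _ ≤ MeasureTheory.volume (⋃ i ∈ s, (dist x) '' S i) := MeasureTheory.measure_mono hIcc
      _ ≤ ∑ i ∈ s, MeasureTheory.volume (dist x '' S i) :=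
        MeasureTheory.measure_biUnion_finset_le s _
      _ ≤ ∑ _i ∈ s, ENNReal.ofReal d := Finset.sum_le_sum hvol
      _ = ENNReal.ofReal (s.card * d) := by
        rw [Finset.sum_const, nsmul_eq_mul, ENNReal.ofReal_mul (Nat.cast_nonneg _),
          ENNReal.ofReal_natCast]
  exact (ENNReal.ofReal_le_ofReal_iff (by positivity)).1 h

theorem isTotallyDisconnected_filledJulia {c : ℂ} (h0 : (0 : ℂ) ∉ filledJulia c) :
    IsTotallyDisconnected (filledJulia c) := by
  obtain ⟨m, hm⟩ : ∃ m, c ∉ trapped c m := by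
    by_contra! h
    refine h0 (zero_mem_filledJulia_of_critical_value_mem ?_)
    rw [filledJulia_eq_iInter_trapped]
    exact mem_iInter.2 h
  set R := escapeRadius c
  have hRpos : 0 < R := escapeRadius_pos c
  set U := openTrapped c m
  have hUo : IsOpen U := isOpen_openTrapped c m
  have hUR : ∀ z ∈ U, ‖z‖ ≤ R := fun z hz =>
    norm_le_of_mem_trapped (openTrapped_subset_trapped c m hz)
  have hEU : trapped c (m + 1) ⊆ U := trapped_succ_subset_openTrapped c m
  have hKE : filledJulia c ⊆ trapped c (m + 1) := filledJulia_subset_trapped c (m + 1)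
  obtain ⟨g, hg, hgsq⟩ := hasSqrtSub_openTrapped hm
  obtain ⟨δ, hδ, hthick⟩ := (isCompact_trapped c (m + 1)).exists_thickening_subset_open hUo hEU
  have hball : ∀ e ∈ trapped c (m + 1), ball e δ ⊆ U := fun e he =>
    (ball_subset_thickening he δ).trans hthick
  have hgE : ∀ σ : ℂ, σ = 1 ∨ σ = -1 → ∀ z ∈ U, σ * g z ∈ trapped c (m + 1) := by
    intro σ hσ z hz
    have hσ2 : σ ^ 2 = 1 := by rcases hσ with rfl | rfl <;> norm_num
    rw [trapped_succ, mem_preimage]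
    have : quadMap c (σ * g z) = z := by simp [quadMap, mul_pow, hσ2, hgsq z hz]
    rw [this]
    exact openTrapped_subset_trapped c m hz
  set t : ℝ := δ / (4 * R) with ht
  have htpos : 0 < t := by positivity
  have hmaps : ∀ σ : ℂ, σ = 1 ∨ σ = -1 → ∀ x ∈ U, ∀ z ∈ U,
      σ * g z + t * (σ * g z - σ * g x) ∈ U := by
    intro σ hσ x hx z hz
    refine hball _ (hgE σ hσ z hz) ?_
    rw [mem_ball, dist_eq_norm, add_sub_cancel_left, norm_mul, Complex.norm_real,
      Real.norm_of_nonneg htpos.le]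
    have h₁ := norm_le_of_mem_trapped (hgE σ hσ z hz)
    have h₂ := norm_le_of_mem_trapped (hgE σ hσ x hx)
    calc t * ‖σ * g z - σ * g x‖ ≤ t * (R + R) := by
          gcongr
          exact (norm_sub_le _ _).trans (add_le_add h₁ h₂)
      _ = δ / 2 := by rw [ht]; field_simp; ring
      _ < δ := half_lt_self hδ
  obtain ⟨s, hsK, hs, hcov⟩ := (isCompact_filledJulia c).finite_cover_balls (half_pos hδ)
  lift s to Finset ℂ using hs
  intro C hCK hC x hx y hy
  have hbound : ∀ n : ℕ, dist x y ≤ s.card * (4 * R * ((1 + t)⁻¹) ^ n) := by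
    intro n
    obtain ⟨G, hGd, hGm, hGi, hGH⟩ :=
      exists_inverse_branch_iterate (hKE.trans hEU) hUo hg hgsq hmaps h0 n C hCK hC
    have hderiv : ∀ e ∈ s, ∀ w ∈ ball e (δ / 2),
        ‖deriv G w‖ ≤ 2 * R / (δ / 2) * ((1 + t)⁻¹) ^ n := by
      intro e he w hw
      have hwU : ball w (δ / 2) ⊆ U := by
        refine Subset.trans (ball_subset_ball' ?_) (hball e (hKE (hsK he)))
        have := mem_ball.1 hw
        linarith
      have hw' : w ∈ U := hwU (mem_ball_self (half_pos hδ))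
      obtain ⟨H, hHd, hHm, -, hH'⟩ := hGH w hw'
      have hle : ‖deriv H w‖ ≤ 2 * R / (δ / 2) := by
        refine Complex.norm_deriv_le_div_of_mapsTo_ball (hHd.mono hwU) (fun z hz => ?_)
          (half_pos hδ)
        rw [mem_closedBall, dist_eq_norm]
        have := norm_sub_le (H z) (H w)
        linarith [hUR _ (hHm (hwU hz)), hUR _ (hHm hw')]
      have hn : ‖((1 : ℂ) + t) ^ n‖ = (1 + t) ^ n := by
        rw [norm_pow, ← Complex.ofReal_one, ← Complex.ofReal_add, Complex.norm_real,
          Real.norm_of_nonneg (by positivity)]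
      rw [hH', norm_mul, hn] at hle
      rw [inv_pow, ← div_eq_mul_inv, le_div_iff₀ (by positivity), mul_comm]
      exact hle
    refine hC.dist_le_card_mul (S := fun e => G '' ball e (δ / 2)) (by positivity) ?_ ?_ hx hy
    · intro z hz
      obtain ⟨e, he, hez⟩ := mem_iUnion₂.1 (hcov (iterate_quadMap_mem_filledJulia (hCK hz) n))
      exact mem_iUnion₂.2 ⟨e, he, _, hez, hGi z hz⟩
    · rintro e he _ ⟨u, hu, rfl⟩ _ ⟨v, hv, rfl⟩
      have hsub : ball e (δ / 2) ⊆ U :=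
        (ball_subset_ball (half_le_self hδ.le)).trans (hball e (hKE (hsK he)))
      have hlip := (convex_ball e (δ / 2)).norm_image_sub_le_of_norm_deriv_le
        (fun w hw => hGd.differentiableAt (hUo.mem_nhds (hsub hw))) (hderiv e he) hv hu
      rw [dist_eq_norm]
      refine hlip.trans ?_
      have huv : ‖u - v‖ ≤ δ := by
        rw [← dist_eq_norm]
        have := dist_triangle_right u v e
        linarith [mem_ball.1 hu, mem_ball.1 hv]
      calc 2 * R / (δ / 2) * ((1 + t)⁻¹) ^ n * ‖u - v‖
          ≤ 2 * R / (δ / 2) * ((1 + t)⁻¹) ^ n * δ := by gcongr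
        _ = 4 * R * ((1 + t)⁻¹) ^ n := by field_simp; ring
  have hlim : Tendsto (fun n : ℕ => s.card * (4 * R * ((1 + t)⁻¹) ^ n)) atTop (𝓝 0) := by
    have := tendsto_pow_atTop_nhds_zero_of_lt_one (r := (1 + t)⁻¹) (by positivity)
      (inv_lt_one_of_one_lt₀ (by linarith))
    simpa using (this.const_mul (4 * R)).const_mul (s.card : ℝ)
  exact dist_le_zero.1 (ge_of_tendsto' hlim hbound)

/-- For every `c ∈ ℂ`: if `0 ∈ K_c` (the critical orbit of
`f_c(z) = z² + c` is bounded) then the filled Julia set `K_c` is connected, and if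
`0 ∉ K_c` then `K_c` is totally disconnected. -/
theorem stmt_10 (c : ℂ) :
    ((0 : ℂ) ∈ filledJulia c → IsConnected (filledJulia c)) ∧
    ((0 : ℂ) ∉ filledJulia c → IsTotallyDisconnected (filledJulia c)) := by
  refine ⟨fun h => ⟨⟨0, h⟩, isPreconnected_filledJulia ?_⟩, isTotallyDisconnected_filledJulia⟩
  simpa [quadMap] using quadMap_mem_filledJulia h
end

section
/- The Mandelbrot set M is a connected subset of ℂ. -/
/-- The Mandelbrot set: parameters with bounded critical orbit. -/
def mandelbrot : Set ℂ := {c : ℂ | (0 : ℂ) ∈ filledJulia c}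

open Set Filter Topology Polynomial

section ConnectedSets

/-- A decreasing intersection of compact preconnected sets is preconnected. -/
theorem isPreconnected_iInter_of_directed {X ι : Type*} [TopologicalSpace X] [T2Space X]
    [NormalSpace X] [Nonempty ι] {K : ι → Set X} (hK : Directed (· ⊇ ·) K)
    (hc : ∀ i, IsCompact (K i)) (hp : ∀ i, IsPreconnected (K i)) :
    IsPreconnected (⋂ i, K i) := by
  rw [isPreconnected_iff_subset_of_fully_disjoint_closed
    (isClosed_iInter fun i => (hc i).isClosed)]
  intro u v hu hv huv hd
  obtain ⟨U, V, hU, hV, huU, hvV, hUV⟩ := normal_separation hu hv hd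
  obtain ⟨i, hi⟩ := exists_subset_nhds_of_isCompact hK hc (U := U ∪ V) fun x hx =>
    (hU.union hV).mem_nhds (union_subset_union huU hvV (huv hx))
  rcases (isPreconnected_iff_subset_of_disjoint.1 (hp i)) U V hU hV hi
    (by rw [hUV.inter_eq, inter_empty]) with h | h
  · left
    intro x hx
    refine (huv hx).resolve_right fun hxv => ?_
    exact hUV.notMem_of_mem_left (h (mem_iInter.1 hx i)) (hvV hxv)
  · right
    intro x hx
    refine (huv hx).resolve_left fun hxu => ?_
    exact hUV.notMem_of_mem_left (huU hxu) (h (mem_iInter.1 hx i))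

/-- A sublevel set in a connected space is preconnected if the level set bounding it is
preconnected and nonempty. -/
theorem isPreconnected_sublevel {X : Type*} [TopologicalSpace X] [PreconnectedSpace X]
    {g : X → ℝ} (hg : Continuous g) {s : ℝ} (hs : IsConnected {x | g x = s}) :
    IsPreconnected {x | g x ≤ s} := by
  have hcl : IsClosed {x | g x ≤ s} := isClosed_le hg continuous_const
  have hsub : {x | g x = s} ⊆ {x | g x ≤ s} := fun x hx => le_of_eq hx
  have key : ∀ u v : Set X, IsClosed u → IsClosed v → {x | g x ≤ s} ⊆ u ∪ v → Disjoint u v →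
      {x | g x = s} ⊆ u → {x | g x ≤ s} ⊆ u := by
    intro u v hu hv huv hd hsu
    have hB : {x | g x ≤ s} ∩ v = {x | g x < s} ∩ uᶜ := by
      ext x
      constructor
      · rintro ⟨hx, hxv⟩
        have hxu : x ∉ u := hd.notMem_of_mem_right hxv
        exact ⟨lt_of_le_of_ne hx fun h => hxu (hsu h), hxu⟩
      · rintro ⟨hx, hxu⟩
        have hx' : g x ≤ s := le_of_lt hx
        exact ⟨hx', (huv hx').resolve_left hxu⟩
    have hclopen : IsClopen ({x | g x ≤ s} ∩ v) :=
      ⟨hcl.inter hv, hB ▸ (isOpen_lt hg continuous_const).inter hu.isOpen_compl⟩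
    rcases isClopen_iff.1 hclopen with h | h
    · intro x hx
      refine (huv hx).resolve_right fun hxv => ?_
      exact (h ▸ (⟨hx, hxv⟩ : x ∈ {x | g x ≤ s} ∩ v) : x ∈ (∅ : Set X))
    · obtain ⟨x, hx⟩ := hs.nonempty
      have hxv : x ∈ {x | g x ≤ s} ∩ v := h ▸ mem_univ x
      exact absurd hxv.2 (hd.notMem_of_mem_left (hsu hx))
  rw [isPreconnected_iff_subset_of_fully_disjoint_closed hcl]
  intro u v hu hv huv hd
  rcases (isPreconnected_iff_subset_of_disjoint_closed.1 hs.isPreconnected) u v hu hv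
    (hsub.trans huv) (by rw [hd.inter_eq, inter_empty]) with h | h
  · exact Or.inl (key u v hu hv huv hd h)
  · exact Or.inr (key v u hv hu (by rwa [union_comm]) hd.symm h)

end ConnectedSets

section Lemniscate

/-- A continuous `d`-th root of an open map is open, away from zero. -/
theorem nhds_le_map_of_pow {P F : ℂ → ℂ} {d : ℕ} (hd : d ≠ 0) {c : ℂ}
    (hP : 𝓝 (P c) ≤ map P (𝓝 c)) (hF : ContinuousAt F c) (hFP : ∀ᶠ x in 𝓝 c, F x ^ d = P x)
    (h0 : F c ≠ 0) : 𝓝 (F c) ≤ map F (𝓝 c) := by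
  have hder : HasStrictDerivAt (fun w : ℂ => w ^ d) (d * F c ^ (d - 1)) (F c) :=
    hasStrictDerivAt_pow d (F c)
  have hne : (d : ℂ) * F c ^ (d - 1) ≠ 0 :=
    mul_ne_zero (Nat.cast_ne_zero.2 hd) (pow_ne_zero _ h0)
  obtain ⟨W, hW, hinj⟩ : ∃ W ∈ 𝓝 (F c), InjOn (fun w : ℂ => w ^ d) W := by
    let e := (hder.hasStrictFDerivAt_equiv hne).toOpenPartialHomeomorph (fun w : ℂ => w ^ d)
    exact ⟨e.source, e.open_source.mem_nhds
      (hder.hasStrictFDerivAt_equiv hne).mem_toOpenPartialHomeomorph_source, e.injOn⟩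
  intro S hS
  have h1 : {x | F x ∈ S ∧ F x ∈ W ∧ F x ^ d = P x} ∈ 𝓝 c := by
    filter_upwards [hS, hF hW, hFP] with x hx hx' hx''
    exact ⟨hx, hx', hx''⟩
  have h2 := hP (image_mem_map h1)
  have h3 : (fun w : ℂ => w ^ d) ⁻¹' (P '' {x | F x ∈ S ∧ F x ∈ W ∧ F x ^ d = P x}) ∈
      𝓝 (F c) := by
    refine (continuous_pow d).continuousAt.preimage_mem_nhds ?_
    rwa [hFP.self_of_nhds]
  filter_upwards [h3, hW] with w hw hwW
  obtain ⟨x, ⟨hxS, hxW, hx⟩, hxw⟩ := hw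
  rwa [hinj hwW hxW (hxw.symm.trans hx.symm)]

/-- If a polynomial `P` of degree `d` has a continuous `d`-th root where `r < ‖P‖`, then the level
sets of `‖P‖` there are connected. -/
theorem Polynomial.isConnected_level_of_root {P : ℂ[X]} (hd : 0 < P.natDegree) {r s : ℝ}
    (hr : 0 ≤ r) (hrs : r < s) {F : ℂ → ℂ} (hF : ContinuousOn F {c | r < ‖P.eval c‖})
    (hFP : ∀ c, r < ‖P.eval c‖ → F c ^ P.natDegree = P.eval c) :
    IsConnected {c | ‖P.eval c‖ = s} := by
  set d := P.natDegree with hd_def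
  set V : Set ℂ := {c | r < ‖P.eval c‖} with hV
  set Q : Set ℂ := {c | ‖P.eval c‖ = s} with hQ
  have hs : 0 < s := hr.trans_lt hrs
  have hdeg : 0 < P.degree := natDegree_pos_iff_degree_pos.1 hd
  have hVo : IsOpen V := isOpen_lt continuous_const P.continuous.norm
  have hQV : Q ⊆ V := fun c hc => show r < ‖P.eval c‖ from (show ‖P.eval c‖ = s from hc) ▸ hrs
  have hQc : IsCompact Q := by
    refine Metric.isCompact_of_isClosed_isBounded
      (isClosed_eq P.continuous.norm continuous_const) ?_
    have h := (P.tendsto_norm_atTop hdeg tendsto_norm_cobounded_atTop).eventually_gt_atTop s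
    rw [← Bornology.isCobounded_compl_iff]
    filter_upwards [h] with c hc
    exact fun hc' => hc.ne' hc'
  have hQn : Q.Nonempty := by
    obtain ⟨c, hc⟩ := IsAlgClosed.exists_root (P - C (s : ℂ))
      (by rw [degree_sub_C hdeg]; exact hdeg.ne')
    refine ⟨c, ?_⟩
    have : P.eval c = s := by simpa [IsRoot, sub_eq_zero] using hc
    simp [hQ, this, abs_of_pos hs]
  obtain ⟨σ, hσ, hσd⟩ : ∃ σ : ℝ, 0 ≤ σ ∧ σ ^ d = s :=
    ⟨s ^ ((d : ℝ)⁻¹), Real.rpow_nonneg hs.le _, Real.rpow_inv_natCast_pow hs.le hd.ne'⟩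
  have hmem : ∀ c ∈ V, F c ∈ Metric.sphere (0 : ℂ) σ ↔ c ∈ Q := by
    intro c hc
    have : ‖P.eval c‖ = ‖F c‖ ^ d := by rw [← hFP c hc, norm_pow]
    rw [mem_sphere_zero_iff_norm, hQ, mem_ofPred_eq, this, ← hσd]
    exact (pow_left_inj₀ (norm_nonneg _) hσ hd.ne').symm
  have hopen : IsOpen (F '' V) := by
    rw [isOpen_iff_mem_nhds]
    rintro _ ⟨c, hc, rfl⟩
    have hPo : IsOpenMap fun z => P.eval z := by
      refine (AnalyticOnNhd.is_constant_or_isOpenMap (g := fun z => P.eval z)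
        (fun z _ => P.differentiable.analyticAt z)).resolve_left ?_
      rintro ⟨w, hw⟩
      obtain ⟨q, hq⟩ := IsAlgClosed.exists_root (P - C (w + 1))
        (by rw [degree_sub_C hdeg]; exact hdeg.ne')
      have : P.eval q = w + 1 := by simpa [IsRoot, sub_eq_zero] using hq
      simp [hw q] at this
    refine nhds_le_map_of_pow (P := fun z => P.eval z) hd.ne' (hPo.nhds_le c)
      (hF.continuousAt (hVo.mem_nhds hc))
      (by filter_upwards [hVo.mem_nhds hc] with x hx using hFP x hx) ?_
      (image_mem_map (hVo.mem_nhds hc))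
    intro h0
    have h1 := hFP c hc
    rw [h0, zero_pow hd.ne'] at h1
    have h2 : r < ‖P.eval c‖ := hc
    rw [← h1, norm_zero] at h2
    exact absurd h2 hr.not_gt
  have hS : IsPreconnected (Metric.sphere (0 : ℂ) σ) :=
    isPreconnected_sphere (by simp) 0 σ
  have hsurj : Metric.sphere (0 : ℂ) σ ⊆ F '' Q := by
    by_contra hnot
    obtain ⟨y, hyS, hyQ⟩ := not_subset.1 hnot
    obtain ⟨c, hc⟩ := hQn
    obtain ⟨z, hzS, ⟨c', hc', rfl⟩, hzQ⟩ := hS (F '' V) (F '' Q)ᶜ hopen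
      (hQc.image_of_continuousOn (hF.mono hQV)).isClosed.isOpen_compl
      (fun z _ => by
        by_cases hz : z ∈ F '' Q
        · exact Or.inl (image_mono hQV hz)
        · exact Or.inr hz)
      ⟨F c, (hmem c (hQV hc)).2 hc, mem_image_of_mem F (hQV hc)⟩ ⟨y, hyS, hyQ⟩
    exact hzQ (mem_image_of_mem F ((hmem c' hc').1 hzS))
  have hinj : InjOn F Q := by
    intro a ha b hb hab
    set w := F a with hw
    have hwd : w ^ d = P.eval a := hFP a (hQV ha)
    have hwn : ‖w ^ d‖ = s := hwd ▸ ha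
    have hPw : P - C (w ^ d) ≠ 0 := by
      intro h
      have := degree_sub_C (a := w ^ d) hdeg
      rw [h, degree_zero] at this
      rw [← this] at hdeg
      exact absurd hdeg (by simp)
    have hZ : ∀ z, z ∈ (P - C (w ^ d)).roots.toFinset ↔ P.eval z = w ^ d := by
      intro z
      rw [Multiset.mem_toFinset, mem_roots hPw, IsRoot, eval_sub, eval_C, sub_eq_zero]
    have hcard : (nthRoots d (w ^ d)).toFinset.card = d := by
      have hζ := Complex.isPrimitiveRoot_exp d hd.ne'
      have hne : w ^ d ≠ 0 := norm_pos_iff.1 (hwn ▸ hs)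
      rw [Multiset.toFinset_card_of_nodup (hζ.nthRoots_nodup hne), hζ.card_nthRoots,
        if_pos ⟨w, rfl⟩]
    have hmaps : MapsTo F (P - C (w ^ d)).roots.toFinset (nthRoots d (w ^ d)).toFinset := by
      intro z hz
      have hz' := (hZ z).1 hz
      have hzQ : z ∈ Q := by rw [hQ, mem_ofPred_eq, hz', hwn]
      simp [mem_nthRoots hd, hFP z (hQV hzQ), hz']
    have hsurjOn : SurjOn F (P - C (w ^ d)).roots.toFinset (nthRoots d (w ^ d)).toFinset := by
      intro x hx
      have hx' : x ^ d = w ^ d := by simpa [mem_nthRoots hd] using hx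
      have hxS : x ∈ Metric.sphere (0 : ℂ) σ := by
        rw [mem_sphere_zero_iff_norm, ← pow_left_inj₀ (norm_nonneg _) hσ hd.ne', ← norm_pow, hx',
          hwn, hσd]
      obtain ⟨z, hz, rfl⟩ := hsurj hxS
      exact ⟨z, (hZ z).2 (by rw [← hx', hFP z (hQV hz)]), rfl⟩
    refine Finset.injOn_of_surjOn_of_card_le F hmaps hsurjOn ?_ ((hZ a).2 hwd.symm)
      ((hZ b).2 (by rw [← hFP b (hQV hb), ← hab])) hab
    rw [hcard]
    exact (Multiset.toFinset_card_le _).trans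
      ((card_roots' _).trans (natDegree_sub_C (p := P) (a := w ^ d)).le)
  refine ⟨hQn, ?_⟩
  have : CompactSpace Q := isCompact_iff_compactSpace.1 hQc
  have hpre := hS.preimage_of_isClosedMap (f := Q.domRestrict F) hinj.injective
    ((hF.mono hQV).domRestrict.isClosedMap) (by rwa [range_domRestrict])
  rw [isPreconnected_iff_preconnectedSpace]
  refine ⟨?_⟩
  convert hpre
  symm
  rw [eq_univ_iff_forall]
  exact fun c => (hmem c (hQV c.2)).2 c.2

end Lemniscate

section Logarithm

/-- A nonvanishing continuous function on a family of star-shaped domains, normalized to be `1` at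
the centers, has a continuous logarithm normalized to be `0` at the centers. -/
theorem exists_continuousOn_log {X : Type*} [TopologicalSpace X] {S : Set (X × ℂ)}
    (hS : ∀ c u, (c, u) ∈ S → ∀ t : unitInterval, (c, ((t : ℝ) : ℂ) * u) ∈ S)
    {h : X × ℂ → ℂ} (hc : ContinuousOn h S) (h0 : ∀ x ∈ S, h x ≠ 0) (h1 : ∀ c, h (c, 0) = 1) :
    ∃ K : X × ℂ → ℂ, ContinuousOn K S ∧ (∀ x ∈ S, Complex.exp (K x) = h x) ∧
      ∀ c, K (c, 0) = 0 := by
  classical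
  have hmem : ∀ q : unitInterval × S, (q.2.1.1, ((q.1 : ℝ) : ℂ) * q.2.1.2) ∈ S :=
    fun q => hS _ _ q.2.2 q.1
  let H : C(unitInterval × S, {z : ℂ // z ≠ 0}) :=
    ⟨fun q => ⟨h (q.2.1.1, ((q.1 : ℝ) : ℂ) * q.2.1.2), h0 _ (hmem q)⟩, by
      refine Continuous.subtype_mk (hc.comp_continuous ?_ hmem) _
      fun_prop⟩
  have H0 : ∀ a : S, H (0, a) = ⟨_, Complex.exp_ne_zero ((ContinuousMap.const S (0 : ℂ)) a)⟩ := by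
    intro a
    ext
    simp [H, h1]
  let Γ := Complex.isCoveringMap_exp.liftHomotopy H (ContinuousMap.const S (0 : ℂ)) H0
  have hΓ : ∀ q, Complex.exp (Γ q) = H q := fun q =>
    congrArg Subtype.val (congrFun (Complex.isCoveringMap_exp.liftHomotopy_lifts H _ H0) q)
  have hΓ0 : ∀ a, Γ (0, a) = 0 := fun a =>
    Complex.isCoveringMap_exp.liftHomotopy_zero H _ H0 a
  have hΓc : ∀ c, ∀ hx : (c, (0 : ℂ)) ∈ S, Γ (1, ⟨(c, 0), hx⟩) = 0 := by
    intro c hx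
    have := (Complex.isCoveringMap_exp.eq_liftHomotopy_iff (f := ContinuousMap.const S (0 : ℂ))
      (H := H) H0 (fun q => if q.2.1.2 = 0 then 0 else Γ q)).2 ?_
    · have h2 := congrFun this (1, ⟨(c, 0), hx⟩)
      simpa only [if_pos] using h2.symm
    · refine ⟨fun a => ?_, ?_, fun a => ?_⟩
      · by_cases ha : a.1.2 = 0
        · simpa [ha] using continuous_const
        · simp only [ha, if_false]
          exact Γ.continuous.comp (by fun_prop)
      · ext q
        by_cases ha : q.2.1.2 = 0
        · simp [ha, H, h1]
        · simp [ha, hΓ]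
      · simp [hΓ0]
  refine ⟨fun x => if hx : x ∈ S then Γ (1, ⟨x, hx⟩) else 0, ?_, ?_, ?_⟩
  · rw [continuousOn_iff_continuous_domRestrict]
    have : Continuous fun x : S => Γ (1, x) := Γ.continuous.comp (by fun_prop)
    convert this using 1
    ext x
    simp
  · intro x hx
    simp only [hx, dif_pos, hΓ]
    simp [H]
  · intro c
    by_cases hx : (c, (0 : ℂ)) ∈ S
    · simp [hx, hΓc]
    · simp [hx]

end Logarithm

section CriticalOrbit

/-- The polynomial in `c` giving the `n`-th point of the critical orbit of `z ↦ z² + c`. -/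
noncomputable def critPoly : ℕ → ℂ[X]
  | 0 => 0
  | n + 1 => critPoly n ^ 2 + X

theorem eval_critPoly (n : ℕ) (c : ℂ) :
    (critPoly n).eval c = (fun w : ℂ => w ^ 2 + c)^[n] 0 := by
  induction n with
  | zero => simp [critPoly]
  | succ n ih => simp [critPoly, Function.iterate_succ_apply', ih]

theorem eval_critPoly_succ (n : ℕ) (c : ℂ) :
    (critPoly (n + 1)).eval c = (critPoly n).eval c ^ 2 + c := by
  simp [critPoly]

theorem eval_critPoly_succ' (n : ℕ) (c : ℂ) :
    (critPoly (n + 1)).eval c = (fun w : ℂ => w ^ 2 + c)^[n] c := by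
  rw [eval_critPoly, Function.iterate_succ_apply]
  simp

theorem natDegree_critPoly_succ (n : ℕ) : (critPoly (n + 1)).natDegree = 2 ^ n := by
  induction n with
  | zero => simp [critPoly]
  | succ n ih =>
    have h : (critPoly (n + 1) ^ 2).natDegree = 2 ^ (n + 1) := by
      rw [natDegree_pow, ih, pow_succ']
    rw [critPoly, natDegree_add_eq_left_of_natDegree_lt, h]
    rw [h, natDegree_X]
    exact Nat.one_lt_two_pow (Nat.succ_ne_zero n)

theorem norm_le_norm_critPoly {c : ℂ} (hc : 2 < ‖c‖) (n : ℕ) :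
    ‖c‖ ≤ ‖(critPoly (n + 1)).eval c‖ := by
  induction n with
  | zero => simp [critPoly]
  | succ n ih =>
    rw [eval_critPoly_succ]
    have h := norm_sub_le_norm_add ((critPoly (n + 1)).eval c ^ 2) c
    rw [norm_pow] at h
    nlinarith

theorem norm_critPoly_lt_succ {c : ℂ} {n : ℕ} (h : 2 < ‖(critPoly (n + 1)).eval c‖) :
    ‖(critPoly (n + 1)).eval c‖ < ‖(critPoly (n + 2)).eval c‖ := by
  have hc : ‖c‖ ≤ ‖(critPoly (n + 1)).eval c‖ := by
    rcases le_or_gt ‖c‖ 2 with h2 | h2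
    · exact h2.trans h.le
    · exact norm_le_norm_critPoly h2 n
  rw [eval_critPoly_succ (n + 1)]
  have h' := norm_sub_le_norm_add ((critPoly (n + 1)).eval c ^ 2) c
  rw [norm_pow] at h'
  nlinarith

theorem norm_critPoly_add_le {c : ℂ} {n : ℕ} (h : 2 < ‖(critPoly (n + 1)).eval c‖) (k : ℕ) :
    ‖(critPoly (n + 1)).eval c‖ + k * (‖(critPoly (n + 1)).eval c‖ - 2) ≤
      ‖(critPoly (n + k + 1)).eval c‖ := by
  have hc : ‖c‖ ≤ ‖(critPoly (n + 1)).eval c‖ := by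
    rcases le_or_gt ‖c‖ 2 with h2 | h2
    · exact h2.trans h.le
    · exact norm_le_norm_critPoly h2 n
  induction k with
  | zero => simp
  | succ k ih =>
    have h' := norm_sub_le_norm_add ((critPoly (n + k + 1)).eval c ^ 2) c
    rw [norm_pow] at h'
    rw [← add_assoc, eval_critPoly_succ (n + k + 1)]
    push_cast
    have hk : 0 ≤ (k : ℝ) * (‖(critPoly (n + 1)).eval c‖ - 2) :=
      mul_nonneg k.cast_nonneg (by linarith)
    nlinarith

theorem norm_critPoly_lt {c : ℂ} {n : ℕ} (h : 2 < ‖(critPoly (n + 1)).eval c‖) {i : ℕ}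
    (hi : i < n) : ‖(critPoly (i + 1)).eval c‖ < ‖(critPoly (n + 1)).eval c‖ := by
  rcases le_or_gt ‖(critPoly (i + 1)).eval c‖ 2 with h2 | h2
  · exact h2.trans_lt h
  · have h3 := norm_critPoly_add_le h2 (n - i)
    rw [show i + (n - i) = n by omega] at h3
    have : (0 : ℝ) < ((n - i : ℕ) : ℝ) := by
      exact_mod_cast Nat.sub_pos_of_lt hi
    nlinarith [mul_pos this (sub_pos.2 h2)]

end CriticalOrbit

section InverseBottcher

/-- If `T c` bounds the first `N` points of the orbit of the critical value of `z ↦ z² + c`, then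
for `j ≤ N` the equation `f_c^j (z) = w ^ 2 ^ j` on `T c < ‖w‖ ^ 2 ^ j` is solved by a continuous
function `z = w * exp (L (c, w⁻¹))` which is bijective onto `T c < ‖f_c^j (z)‖`. -/
theorem exists_inverse_bottcher {N : ℕ} {T : ℂ → ℝ} (hT0 : ∀ c, 0 ≤ T c)
    (hT : ∀ c, ∀ i < N, ‖(fun w : ℂ => w ^ 2 + c)^[i] c‖ ≤ T c) (j : ℕ) (hj : j ≤ N) :
    ∃ L : ℂ × ℂ → ℂ, ContinuousOn L {x | T x.1 * ‖x.2‖ ^ 2 ^ j < 1} ∧ (∀ c, L (c, 0) = 0) ∧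
      (∀ c w, T c < ‖w‖ ^ 2 ^ j →
        (fun w : ℂ => w ^ 2 + c)^[j] (w * Complex.exp (L (c, w⁻¹))) = w ^ 2 ^ j) ∧
      (∀ c w w', T c < ‖w‖ ^ 2 ^ j → T c < ‖w'‖ ^ 2 ^ j →
        w * Complex.exp (L (c, w⁻¹)) = w' * Complex.exp (L (c, w'⁻¹)) → w = w') ∧
      ∀ c z, T c < ‖(fun w : ℂ => w ^ 2 + c)^[j] z‖ →
        ∃ w, w ^ 2 ^ j = (fun w : ℂ => w ^ 2 + c)^[j] z ∧ w * Complex.exp (L (c, w⁻¹)) = z := by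
  have hne : ∀ {c w : ℂ} {k : ℕ}, T c < ‖w‖ ^ 2 ^ k → w ≠ 0 := by
    rintro c w k hw rfl
    rw [norm_zero, zero_pow (by positivity)] at hw
    exact (hT0 c).not_gt hw
  induction j with
  | zero => exact ⟨fun _ => 0, continuousOn_const, by simp, by simp, by simp, by simp⟩
  | succ j ih =>
    obtain ⟨L, hLc, hL0, hLf, hLi, hLs⟩ := ih (by omega)
    have hdom : ∀ {c v : ℂ}, v ≠ 0 → T c * ‖v‖ ^ 2 ^ j < 1 → T c < ‖v⁻¹‖ ^ 2 ^ j := by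
      intro c v hv h
      have : 0 < ‖v‖ ^ 2 ^ j := by positivity
      rw [norm_inv, inv_pow, ← one_div, lt_div_iff₀ this]
      exact h
    have hstar : ∀ c u, (c, u) ∈ {x : ℂ × ℂ | T x.1 * ‖x.2‖ ^ 2 ^ j < 1} →
        ∀ t : unitInterval,
          (c, ((t : ℝ) : ℂ) * u) ∈ {x : ℂ × ℂ | T x.1 * ‖x.2‖ ^ 2 ^ j < 1} := by
      intro c u hu t
      simp only [mem_ofPred_eq] at hu ⊢
      refine lt_of_le_of_lt ?_ hu
      simp only [norm_mul, Complex.norm_real, Real.norm_eq_abs, abs_of_nonneg t.2.1]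
      have := mul_le_of_le_one_left (norm_nonneg u) t.2.2
      have := hT0 c
      have := t.2.1
      gcongr
    have hnv : ∀ x ∈ {x : ℂ × ℂ | T x.1 * ‖x.2‖ ^ 2 ^ j < 1},
        Complex.exp (L x) - x.1 * x.2 ≠ 0 := by
      rintro ⟨c, v⟩ hv hzero
      simp only [sub_eq_zero] at hzero
      rcases eq_or_ne v 0 with rfl | hv0
      · simp [hL0] at hzero
      · have h1 := hdom hv0 hv
        have h2 := hLf c v⁻¹ h1
        rw [inv_inv, hzero, show v⁻¹ * (c * v) = c by field_simp] at h2
        have h3 := hT c j (by omega)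
        rw [h2, norm_pow] at h3
        exact h3.not_gt h1
    obtain ⟨K, hKc, hKe, hK0⟩ := exists_continuousOn_log
      (h := fun x => Complex.exp (L x) - x.1 * x.2) hstar
      ((Complex.continuous_exp.comp_continuousOn hLc).sub
        (continuous_fst.mul continuous_snd).continuousOn) hnv (by simp [hL0])
    have hdom2 : ∀ {c w : ℂ}, T c < ‖w‖ ^ 2 ^ (j + 1) → T c < ‖w ^ 2‖ ^ 2 ^ j := by
      intro c w hw
      rwa [norm_pow, ← pow_mul, ← pow_succ']
    have hdomS : ∀ {c w : ℂ}, T c < ‖w‖ ^ 2 ^ (j + 1) → T c * ‖(w⁻¹) ^ 2‖ ^ 2 ^ j < 1 := by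
      intro c w hw
      have h0 := norm_pos_iff.2 (hne hw)
      rw [norm_pow, ← pow_mul, ← pow_succ', norm_inv, inv_pow, ← div_eq_mul_inv,
        div_lt_one (by positivity)]
      exact hw
    have hsq : ∀ {c w : ℂ}, T c < ‖w‖ ^ 2 ^ (j + 1) →
        (w * Complex.exp (K (c, w⁻¹ ^ 2) / 2)) ^ 2 + c =
          w ^ 2 * Complex.exp (L (c, (w ^ 2)⁻¹)) := by
      intro c w hw
      have h0 := hne hw
      have h1 := hKe (c, w⁻¹ ^ 2) (hdomS hw)
      rw [mul_pow, ← Complex.exp_nat_mul, Nat.cast_ofNat, mul_div_cancel₀ _ two_ne_zero, h1,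
        inv_pow]
      field_simp
      ring
    refine ⟨fun x => K (x.1, x.2 ^ 2) / 2, ?_, ?_, ?_, ?_, ?_⟩
    · refine ContinuousOn.div_const (hKc.comp (by fun_prop) ?_) 2
      rintro ⟨c, u⟩ hu
      simpa only [mem_ofPred_eq, norm_pow, ← pow_mul, ← pow_succ'] using hu
    · simp [hK0]
    · intro c w hw
      rw [Function.iterate_succ_apply]
      simp only
      rw [hsq hw, hLf c _ (hdom2 hw), ← pow_mul, ← pow_succ']
    · intro c w w' hw hw' h
      simp only at h
      have h1 := hLi c _ _ (hdom2 hw) (hdom2 hw') (by rw [← hsq hw, ← hsq hw', h])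
      rcases sq_eq_sq_iff_eq_or_eq_neg.1 h1 with h2 | h2
      · exact h2
      · exfalso
        rw [h2, inv_neg, neg_sq, neg_mul, neg_eq_self] at h
        exact mul_ne_zero (hne hw') (Complex.exp_ne_zero _) h
    · intro c z hz
      rw [Function.iterate_succ_apply] at hz
      obtain ⟨w₀, hw₀, hψ⟩ := hLs c _ hz
      obtain ⟨w, hw⟩ := IsAlgClosed.exists_pow_nat_eq w₀ (n := 2) two_pos
      have hwz : w ^ 2 ^ (j + 1) = (fun w : ℂ => w ^ 2 + c)^[j + 1] z := by
        rw [Function.iterate_succ_apply, ← hw₀, ← hw, ← pow_mul, ← pow_succ']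
      have hwT : T c < ‖w‖ ^ 2 ^ (j + 1) := by
        rwa [← norm_pow, hwz, Function.iterate_succ_apply]
      have h1 := hsq hwT
      rw [hw, hψ, add_left_inj] at h1
      rcases sq_eq_sq_iff_eq_or_eq_neg.1 h1 with h2 | h2
      · exact ⟨w, hwz, h2⟩
      · refine ⟨-w, ?_, ?_⟩
        · rw [← hwz, Even.neg_pow]
          exact (even_two.pow_of_ne_zero (Nat.succ_ne_zero j))
        · simp only [inv_neg, neg_sq, neg_mul, h2, neg_neg]

end InverseBottcher

section Root

/-- The polynomial `critPoly (N + 1)` has a continuous root of order its degree where its modulus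
exceeds `2`. -/
theorem exists_continuousOn_root_critPoly (N : ℕ) :
    ∃ F : ℂ → ℂ, ContinuousOn F {c | 2 < ‖(critPoly (N + 1)).eval c‖} ∧
      ∀ c, 2 < ‖(critPoly (N + 1)).eval c‖ → F c ^ 2 ^ N = (critPoly (N + 1)).eval c := by
  set V : Set ℂ := {c | 2 < ‖(critPoly (N + 1)).eval c‖} with hV
  let T : ℂ → NNReal := fun c =>
    (Finset.range N).sup fun i => ‖(fun w : ℂ => w ^ 2 + c)^[i] c‖₊
  have hTV : ∀ c ∈ V, (T c : ℝ) < ‖(critPoly (N + 1)).eval c‖ := by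
    intro c hc
    rw [← coe_nnnorm, NNReal.coe_lt_coe, Finset.sup_lt_iff]
    · intro i hi
      have := norm_critPoly_lt hc (Finset.mem_range.1 hi)
      rwa [eval_critPoly_succ' i] at this
    · have : (2 : ℝ) < ‖(critPoly (N + 1)).eval c‖ := hc
      rw [bot_eq_zero, nnnorm_pos, ← norm_pos_iff]
      linarith
  obtain ⟨L, hLc, -, -, hLi, hLs⟩ := exists_inverse_bottcher (T := fun c => (T c : ℝ))
    (fun c => (T c).2)
    (fun c i hi => NNReal.coe_le_coe.2 (Finset.le_sup
      (f := fun i => ‖(fun w : ℂ => w ^ 2 + c)^[i] c‖₊) (Finset.mem_range.2 hi))) N le_rfl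
  have hex : ∀ c, ∃ w, c ∈ V → w ^ 2 ^ N = (critPoly (N + 1)).eval c ∧
      w * Complex.exp (L (c, w⁻¹)) = c := by
    intro c
    by_cases hc : c ∈ V
    · obtain ⟨w, hw⟩ := hLs c c (by rw [← eval_critPoly_succ']; exact hTV c hc)
      rw [← eval_critPoly_succ'] at hw
      exact ⟨w, fun _ => hw⟩
    · exact ⟨0, fun h => absurd h hc⟩
  choose F hF using hex
  refine ⟨F, ?_, fun c hc => (hF c hc).1⟩
  have hTw : ∀ c ∈ V, ∀ w : ℂ, w ^ 2 ^ N = (critPoly (N + 1)).eval c → (T c : ℝ) < ‖w‖ ^ 2 ^ N := by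
    intro c hc w hw
    rw [← norm_pow, hw]
    exact hTV c hc
  intro c₀ hc₀
  have hPc : Tendsto (fun c => (critPoly (N + 1)).eval c) (𝓝[V] c₀)
      (𝓝 ((critPoly (N + 1)).eval c₀)) :=
    (critPoly (N + 1)).continuous.continuousWithinAt
  set B := ‖(critPoly (N + 1)).eval c₀‖ + 1 with hB
  have hB1 : 1 ≤ B := by simp [hB]
  refine (isCompact_closedBall (0 : ℂ) B).tendsto_nhds_of_unique_mapClusterPt ?_ ?_
  · filter_upwards [hPc.norm.eventually_lt_const (lt_add_one _), self_mem_nhdsWithin] with c hc hcV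
    rw [mem_closedBall_zero_iff]
    by_contra! hlt
    rw [← (hF c hcV).1, norm_pow] at hc
    have : ‖F c‖ ≤ ‖F c‖ ^ 2 ^ N := le_self_pow₀ (hB1.trans hlt.le) (by positivity)
    linarith
  · intro y _ hy
    obtain ⟨U, hU, hUy⟩ := mapClusterPt_iff_ultrafilter.1 hy
    have hUV : ∀ᶠ c in (U : Filter ℂ), c ∈ V := hU self_mem_nhdsWithin
    have hUc : Tendsto id (U : Filter ℂ) (𝓝 c₀) := hU.trans nhdsWithin_le_nhds
    have hyN : y ^ 2 ^ N = (critPoly (N + 1)).eval c₀ := by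
      refine tendsto_nhds_unique (hUy.pow (2 ^ N)) ((hPc.mono_left hU).congr' ?_)
      filter_upwards [hUV] with c hc using (hF c hc).1.symm
    have hTy := hTw c₀ hc₀ y hyN
    have hmem : ∀ c ∈ V, ∀ w : ℂ, w ^ 2 ^ N = (critPoly (N + 1)).eval c →
        (c, w⁻¹) ∈ {x : ℂ × ℂ | (T x.1 : ℝ) * ‖x.2‖ ^ 2 ^ N < 1} := by
      intro c hc w hw
      have h1 := hTw c hc w hw
      have h2 : 0 < ‖w‖ ^ 2 ^ N := (T c).2.trans_lt h1
      simp only [mem_ofPred_eq, norm_inv, inv_pow]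
      rwa [← div_eq_mul_inv, div_lt_one h2]
    have hy0 : y ≠ 0 := by
      rintro rfl
      rw [norm_zero, zero_pow (by positivity)] at hTy
      exact (T c₀).2.not_gt hTy
    have hψ : y * Complex.exp (L (c₀, y⁻¹)) = c₀ := by
      refine tendsto_nhds_unique (f := fun c => F c * Complex.exp (L (c, (F c)⁻¹)))
        (hUy.mul ((Complex.continuous_exp.tendsto _).comp
          ((hLc _ (hmem c₀ hc₀ y hyN)).tendsto.comp (tendsto_nhdsWithin_iff.2
            ⟨hUc.prodMk_nhds (hUy.inv₀ hy0), ?_⟩)))) (hUc.congr' ?_)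
      · filter_upwards [hUV] with c hc using hmem c hc _ (hF c hc).1
      · filter_upwards [hUV] with c hc using (hF c hc).2.symm
    exact hLi c₀ _ _ hTy (hTw c₀ hc₀ _ (hF c₀ hc₀).1) (hψ.trans (hF c₀ hc₀).2.symm)

end Root

theorem mandelbrot_eq_iInter : mandelbrot = ⋂ n : ℕ, {c | ‖(critPoly (n + 1)).eval c‖ ≤ 3} := by
  ext c
  simp only [mandelbrot, filledJulia, mem_ofPred_eq, mem_iInter, ← eval_critPoly]
  constructor
  · intro h n
    by_contra! hn
    obtain ⟨B, hB⟩ := h.exists_norm_le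
    obtain ⟨k, hk⟩ := exists_nat_gt B
    have h1 := norm_critPoly_add_le (by linarith : 2 < ‖(critPoly (n + 1)).eval c‖) k
    have h2 := hB _ (mem_range_self (n + k + 1))
    have h3 : (0 : ℝ) ≤ k := k.cast_nonneg
    nlinarith
  · intro h
    refine isBounded_iff_forall_norm_le.2 ⟨3, ?_⟩
    rintro _ ⟨n, rfl⟩
    cases n with
    | zero => simp [critPoly]
    | succ n => exact h n

/-- The Mandelbrot set `M` is a connected subset of `ℂ`. -/
theorem stmt_12 : IsConnected mandelbrot := by
  refine ⟨⟨0, ?_⟩, ?_⟩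
  · rw [mandelbrot_eq_iInter, mem_iInter]
    intro n
    have h : ∀ k, (critPoly k).eval 0 = 0 := by
      intro k
      induction k with
      | zero => simp [critPoly]
      | succ k ih => simp [eval_critPoly_succ, ih]
    simp [h]
  rw [mandelbrot_eq_iInter]
  refine isPreconnected_iInter_of_directed ?_ (fun n => ?_) (fun n => ?_)
  · refine directed_of_isDirected_le (antitone_nat_of_succ_le fun n c hc => ?_)
    by_contra hlt
    simp only [mem_ofPred_eq, not_le] at hlt hc
    have := norm_critPoly_lt_succ (show 2 < ‖(critPoly (n + 1)).eval c‖ by linarith)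
    have hc' : ‖(critPoly (n + 2)).eval c‖ ≤ 3 := hc
    linarith
  · refine Metric.isCompact_of_isClosed_isBounded
      (isClosed_le (critPoly (n + 1)).continuous.norm continuous_const) ?_
    refine isBounded_iff_forall_norm_le.2 ⟨3, fun c hc => ?_⟩
    by_contra! hlt
    exact absurd hc (not_le.2 (hlt.trans_le (norm_le_norm_critPoly (by linarith) n)))
  · obtain ⟨F, hF, hFP⟩ := exists_continuousOn_root_critPoly n
    have hdeg := natDegree_critPoly_succ n
    exact isPreconnected_sublevel (critPoly (n + 1)).continuous.norm
      (Polynomial.isConnected_level_of_root (hdeg ▸ by positivity) zero_le_two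
        (by norm_num : (2 : ℝ) < 3) hF (by rwa [hdeg]))
end

section
/- For every holomorphic motion h of X over 𝔻 there exists a holomorphic motion H of the closure of X in ℂ over 𝔻 that extends h; this extension is unique, and H is jointly continuous as a map 𝔻 × cl(X) → ℂ (the λ-lemma, restriction to the closure). -/
/-- A holomorphic motion of a set `A ⊆ ℂ` over the unit disk `𝔻` (with basepoint `0`),
modelled as a total map `h : ℂ → ℂ → ℂ` whose restriction to `𝔻 × A` is the motion:
`h 0 x = x` on `A`, each time-`λ` map is injective on `A`, and each trajectory
`λ ↦ h λ x` is holomorphic on `𝔻`. -/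
def IsHolomorphicMotion (A : Set ℂ) (h : ℂ → ℂ → ℂ) : Prop :=
  (∀ x ∈ A, h 0 x = x) ∧
  (∀ l ∈ Metric.ball (0 : ℂ) 1, Set.InjOn (h l) A) ∧
  (∀ x ∈ A, DifferentiableOn ℂ (fun l => h l x) (Metric.ball (0 : ℂ) 1))

section

open Metric Set Filter Topology

theorem exists_log_on_ball {f : ℂ → ℂ} {R : ℝ} (hf : DifferentiableOn ℂ f (ball 0 R))
    (h0 : ∀ z ∈ ball (0 : ℂ) R, f z ≠ 0) :
    ∃ L : ℂ → ℂ, DifferentiableOn ℂ L (ball 0 R) ∧ L 0 = Complex.log (f 0) ∧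
      ∀ z ∈ ball (0 : ℂ) R, Complex.exp (L z) = f z := by
  have hex : Complex.IsExactOn (fun z => deriv f z / f z) (ball 0 R) :=
    ((hf.deriv isOpen_ball).div hf h0).isExactOn_ball
  obtain ⟨L, hL0, hL⟩ := hex.with_val_at 0 (Complex.log (f 0))
  refine ⟨L, fun z hz => (hL z hz).differentiableAt.differentiableWithinAt, hL0, fun z hz => ?_⟩
  have hR : (0 : ℂ) ∈ ball (0 : ℂ) R := mem_ball_self (nonempty_ball.1 ⟨z, hz⟩)
  have hd : ∀ w ∈ ball (0 : ℂ) R,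
      HasDerivAt (fun w => Complex.exp (-L w) * f w) 0 w := by
    intro w hw
    have h1 : HasDerivAt (fun w => Complex.exp (-L w) * f w)
        (Complex.exp (-L w) * -(deriv f w / f w) * f w + Complex.exp (-L w) * deriv f w) w :=
      (hL w hw).neg.cexp.mul (hf.differentiableAt (isOpen_ball.mem_nhds hw)).hasDerivAt
    have h2 : deriv f w / f w * f w = deriv f w := div_mul_cancel₀ _ (h0 w hw)
    rwa [mul_assoc, neg_mul, h2, mul_neg, neg_add_cancel] at h1
  have hc := isOpen_ball.is_const_of_deriv_eq_zero (convex_ball (0 : ℂ) R).isPreconnected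
    (fun w hw => (hd w hw).differentiableAt.differentiableWithinAt)
    (fun w hw => (hd w hw).deriv) hz hR
  simp only [hL0, Complex.exp_neg, Complex.exp_log (h0 0 hR)] at hc
  rw [inv_mul_cancel₀ (h0 0 hR), inv_mul_eq_one₀ (Complex.exp_ne_zero _)] at hc
  exact hc

theorem norm_log_le {u : ℂ} {A : ℝ} (hu : u ≠ 0) (h1 : ‖u‖ ≤ A) (h2 : ‖u⁻¹‖ ≤ A) :
    ‖Complex.log u‖ ≤ Real.log A + Real.pi := by
  have hpos := norm_pos_iff.2 hu
  refine (Complex.norm_le_abs_re_add_abs_im _).trans (add_le_add ?_ ?_)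
  · rw [Complex.log_re, abs_le]
    refine ⟨?_, Real.log_le_log hpos h1⟩
    rw [norm_inv] at h2
    have := Real.log_le_log (inv_pos.2 hpos) h2
    rw [Real.log_inv] at this
    linarith
  · rw [Complex.log_im]; exact Complex.abs_arg_le_pi u

/-- **Harnack's inequality** for the real part of a holomorphic function. -/
theorem harnack_re {k : ℂ → ℂ} {R : ℝ} (hk : DifferentiableOn ℂ k (ball 0 R))
    (hpos : ∀ z ∈ ball (0 : ℂ) R, 0 < (k z).re) {r : ℝ} (hr : r < R) {z : ℂ} (hz : ‖z‖ ≤ r) :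
    (R - r) * (k 0).re ≤ (R + r) * (k z).re ∧ (R - r) * (k z).re ≤ (R + r) * (k 0).re := by
  have hr0 : 0 ≤ r := (norm_nonneg z).trans hz
  have hzR : z ∈ ball (0 : ℂ) R := mem_ball_zero_iff.2 (hz.trans_lt hr)
  have hR : 0 < R := hr0.trans_lt hr
  have h0 : (0 : ℂ) ∈ ball (0 : ℂ) R := mem_ball_self hR
  have hK := hpos 0 h0
  set c : ℂ := (starRingEnd ℂ) (k 0) with hc
  have hne : ∀ w ∈ ball (0 : ℂ) R, k w + c ≠ 0 := by
    intro w hw h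
    have := congrArg Complex.re h
    simp only [hc, Complex.add_re, Complex.conj_re, Complex.zero_re] at this
    linarith [hpos w hw]
  have hsq : ∀ w, ‖k w - k 0‖ ^ 2
      = ((k w).re - (k 0).re) ^ 2 + ((k w).im - (k 0).im) ^ 2 := by
    intro w; rw [Complex.sq_norm, Complex.normSq_apply]; simp; ring
  have hsq' : ∀ w, ‖k w + c‖ ^ 2
      = ((k w).re + (k 0).re) ^ 2 + ((k w).im - (k 0).im) ^ 2 := by
    intro w; rw [Complex.sq_norm, Complex.normSq_apply]; simp [hc]; ring
  have hs := Complex.dist_le_div_mul_dist_of_mapsTo_ball (R₂ := 1) (c := (0 : ℂ)) (R₁ := R)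
    (f := fun w => (k w - k 0) / (k w + c)) ((hk.sub_const _).div (hk.add_const _) hne)
    (fun w hw => by
      have := norm_pos_iff.2 (hne w hw)
      simp only [sub_self, zero_div, mem_closedBall_zero_iff, norm_div]
      rw [div_le_one this, ← sq_le_sq₀ (norm_nonneg _) this.le, hsq, hsq']
      nlinarith [mul_pos (hpos w hw) hK]) hzR
  have hn := norm_pos_iff.2 (hne z hzR)
  simp only [sub_self, zero_div, dist_zero_right, norm_div] at hs
  have hs2 : R * ‖k z - k 0‖ ≤ r * ‖k z + c‖ := by
    rw [div_mul_eq_mul_div, one_mul, div_le_div_iff₀ hn hR] at hs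
    nlinarith
  have hs3 : R ^ 2 * ‖k z - k 0‖ ^ 2 ≤ r ^ 2 * ‖k z + c‖ ^ 2 := by
    rw [← mul_pow, ← mul_pow]; gcongr
  rw [hsq, hsq'] at hs3
  have ha := hpos z hzR
  have hs4 : (R * ((k z).re - (k 0).re)) ^ 2 ≤ (r * ((k z).re + (k 0).re)) ^ 2 := by
    nlinarith [mul_nonneg (mul_nonneg (sub_nonneg.2 hr.le) (add_pos_of_pos_of_nonneg hR hr0).le)
      (sq_nonneg ((k z).im - (k 0).im))]
  have := abs_le.1 (abs_le_of_sq_le_sq hs4 (by positivity))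
  constructor <;> linarith [this.1, this.2]

/-- Harnack's inequality for `log (M / |φ|)`, where `φ` is zero-free and bounded by `M`. -/
theorem harnack_norm {φ : ℂ → ℂ} {R M r : ℝ} (hφ : DifferentiableOn ℂ φ (ball 0 R))
    (h0 : ∀ z ∈ ball (0 : ℂ) R, φ z ≠ 0) (hM : ∀ z ∈ ball (0 : ℂ) R, ‖φ z‖ < M)
    (hr : r < R) {z : ℂ} (hz : ‖z‖ ≤ r) :
    (R - r) * Real.log (M / ‖φ 0‖) ≤ (R + r) * Real.log (M / ‖φ z‖) ∧
    (R - r) * Real.log (M / ‖φ z‖) ≤ (R + r) * Real.log (M / ‖φ 0‖) := by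
  obtain ⟨L, hL, -, hexp⟩ := exists_log_on_ball hφ h0
  have hzR : z ∈ ball (0 : ℂ) R := mem_ball_zero_iff.2 (hz.trans_lt hr)
  have h0R : (0 : ℂ) ∈ ball (0 : ℂ) R := mem_ball_self (nonempty_ball.1 ⟨z, hzR⟩)
  have hre : ∀ w ∈ ball (0 : ℂ) R, Real.log (M / ‖φ w‖) = ((Real.log M : ℂ) - L w).re := by
    intro w hw
    have hp := norm_pos_iff.2 (h0 w hw)
    rw [Real.log_div (hp.trans (hM w hw)).ne' hp.ne', ← hexp w hw, Complex.norm_exp,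
      Real.log_exp, Complex.sub_re, Complex.ofReal_re]
  rw [hre z hzR, hre 0 h0R]
  refine harnack_re (k := fun w => (Real.log M : ℂ) - L w) (hL.const_sub _) (fun w hw => ?_) hr hz
  rw [← hre w hw]
  exact Real.log_pos ((one_lt_div (norm_pos_iff.2 (h0 w hw))).2 (hM w hw))

theorem exists_norm_lt_of_norm_zero_lt {R M r ε : ℝ} (hM : 0 < M) (hr0 : 0 ≤ r) (hr : r < R)
    (hε : 0 < ε) : ∃ η > 0, ∀ φ : ℂ → ℂ, DifferentiableOn ℂ φ (ball 0 R) →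
      (∀ z ∈ ball (0 : ℂ) R, φ z ≠ 0) → (∀ z ∈ ball (0 : ℂ) R, ‖φ z‖ < M) →
      ‖φ 0‖ < η → ∀ z, ‖z‖ ≤ r → ‖φ z‖ < ε := by
  have h1 : 0 < R - r := sub_pos.2 hr
  refine ⟨M * Real.exp (-((R + r) / (R - r) * Real.log (M / ε))), by positivity,
    fun φ hφ h0 hb hη z hz => ?_⟩
  have hzR : z ∈ ball (0 : ℂ) R := mem_ball_zero_iff.2 (hz.trans_lt hr)
  have h0R : (0 : ℂ) ∈ ball (0 : ℂ) R := mem_ball_self (nonempty_ball.1 ⟨z, hzR⟩)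
  have hp0 := norm_pos_iff.2 (h0 0 h0R)
  have hpz := norm_pos_iff.2 (h0 z hzR)
  have H := (harnack_norm hφ h0 hb hr hz).1
  have h2 := Real.log_lt_log hp0 hη
  rw [Real.log_mul hM.ne' (Real.exp_ne_zero _), Real.log_exp] at h2
  rw [Real.log_div hM.ne' hp0.ne', Real.log_div hM.ne' hpz.ne'] at H
  rw [Real.log_div hM.ne' hε.ne'] at h2
  have h3 : (R + r) * (Real.log M - Real.log ε) < (R + r) * (Real.log M - Real.log ‖φ z‖) := by
    refine lt_of_lt_of_le ?_ H
    have : (R + r) * (Real.log M - Real.log ε)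
        = (R - r) * ((R + r) / (R - r) * (Real.log M - Real.log ε)) := by field_simp
    rw [this]
    exact mul_lt_mul_of_pos_left (by linarith) h1
  have h4 := lt_of_mul_lt_mul_left h3 (by linarith)
  exact (Real.log_lt_log_iff hpz hε).1 (by linarith)

theorem exists_le_norm_of_le_norm_zero {R M r m : ℝ} (hM : 0 < M) (hr : r < R)
    (hm : 0 < m) : ∃ ε > 0, ∀ φ : ℂ → ℂ, DifferentiableOn ℂ φ (ball 0 R) →
      (∀ z ∈ ball (0 : ℂ) R, φ z ≠ 0) → (∀ z ∈ ball (0 : ℂ) R, ‖φ z‖ < M) →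
      m ≤ ‖φ 0‖ → ∀ z, ‖z‖ ≤ r → ε ≤ ‖φ z‖ := by
  have h1 : 0 < R - r := sub_pos.2 hr
  refine ⟨M * Real.exp (-((R + r) / (R - r) * Real.log (M / m))), by positivity,
    fun φ hφ h0 hb hη z hz => ?_⟩
  have hr0 := (norm_nonneg z).trans hz
  have hzR : z ∈ ball (0 : ℂ) R := mem_ball_zero_iff.2 (hz.trans_lt hr)
  have h0R : (0 : ℂ) ∈ ball (0 : ℂ) R := mem_ball_self (nonempty_ball.1 ⟨z, hzR⟩)
  have hp0 := norm_pos_iff.2 (h0 0 h0R)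
  have hpz := norm_pos_iff.2 (h0 z hzR)
  have H := (harnack_norm hφ h0 hb hr hz).2
  have h2 := Real.log_le_log hm hη
  rw [← Real.log_le_log_iff (by positivity) hpz, Real.log_mul hM.ne' (Real.exp_ne_zero _),
    Real.log_exp]
  rw [Real.log_div hM.ne' hp0.ne', Real.log_div hM.ne' hpz.ne'] at H
  rw [Real.log_div hM.ne' hm.ne']
  have h3 : (R - r) * (Real.log M - Real.log ‖φ z‖)
      ≤ (R - r) * ((R + r) / (R - r) * (Real.log M - Real.log m)) := by
    refine H.trans ?_
    have : (R - r) * ((R + r) / (R - r) * (Real.log M - Real.log m))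
        = (R + r) * (Real.log M - Real.log m) := by field_simp
    rw [this]
    exact mul_le_mul_of_nonneg_left (by linarith) (by linarith)
  have := le_of_mul_le_mul_left h3 h1
  linarith

/-- A consequence of **Bloch's theorem**: if the image of `G` contains no disk of radius `ρ`, then
`(1 - |z|) |G'(z)|` is bounded by a multiple of `ρ`. -/
theorem bloch_bound {G : ℂ → ℂ} {ρ : ℝ} (hG : DifferentiableOn ℂ G (ball 0 1))
    (hom : ∀ p : ℂ, ∃ q, dist q p < ρ ∧ q ∉ G '' ball 0 1) {z : ℂ} (hz : z ∈ ball (0 : ℂ) 1) :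
    (1 - ‖z‖) * ‖deriv G z‖ ≤ 96 * ρ := by
  have hz1 : ‖z‖ < 1 := mem_ball_zero_iff.1 hz
  set R : ℝ := (1 + ‖z‖) / 2 with hR
  have hR1 : R < 1 := by linarith
  have hzR : ‖z‖ < R := by linarith
  have hG' : DifferentiableOn ℂ (deriv G) (ball 0 1) := hG.deriv isOpen_ball
  have hsub : closedBall (0 : ℂ) R ⊆ ball 0 1 := closedBall_subset_ball hR1
  obtain ⟨a, ha, hmax⟩ := (isCompact_closedBall (0 : ℂ) R).exists_isMaxOn
    ⟨z, mem_closedBall_zero_iff.2 hzR.le⟩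
    (f := fun w => (R - ‖w‖) * ‖deriv G w‖)
    ((continuous_const.sub continuous_norm).continuousOn.mul (hG'.continuousOn.mono hsub).norm)
  have hmaxz := hmax (mem_closedBall_zero_iff.2 hzR.le)
  simp only [mem_ofPred_eq] at hmaxz
  suffices h : (R - ‖a‖) * ‖deriv G a‖ ≤ 48 * ρ by
    have : R - ‖z‖ = (1 - ‖z‖) / 2 := by rw [hR]; ring
    rw [this] at hmaxz
    linarith
  have hρ : 0 < ρ := by
    obtain ⟨q, hq, -⟩ := hom 0
    exact dist_nonneg.trans_lt hq
  rw [mem_closedBall_zero_iff] at ha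
  by_contra! hcon
  have hs0 : 0 < R - ‖a‖ := by
    rcases (sub_nonneg.2 ha).eq_or_lt with h | h
    · rw [← h] at hcon; linarith
    · exact h
  have hd0 : 0 < ‖deriv G a‖ := by
    rcases (norm_nonneg (deriv G a)).eq_or_lt with h | h
    · rw [← h] at hcon; linarith
    · exact h
  set s : ℝ := (R - ‖a‖) / 2 with hs
  set D : ℝ := ‖deriv G a‖ with hD
  have hspos : 0 < s := by positivity
  have hball : ∀ w ∈ ball a s, ‖w‖ < R - s := by
    intro w hw
    rw [mem_ball_iff_norm] at hw
    have := norm_le_norm_add_norm_sub' w a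
    linarith
  have hballsub : ball a s ⊆ ball 0 1 := fun w hw => by
    rw [mem_ball_zero_iff]; linarith [hball w hw]
  have hle : ∀ w ∈ ball a s, ‖deriv G w‖ ≤ 2 * D := by
    intro w hw
    have h1 := hball w hw
    have h2 := hmax (mem_closedBall_zero_iff.2 (show ‖w‖ ≤ R by linarith))
    simp only [mem_ofPred_eq] at h2
    have h3 : s * ‖deriv G w‖ ≤ s * (2 * D) := by
      calc s * ‖deriv G w‖ ≤ (R - ‖w‖) * ‖deriv G w‖ := by gcongr; linarith
        _ ≤ _ := h2
        _ = s * (2 * D) := by rw [hs]; ring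
    exact le_of_mul_le_mul_left h3 hspos
  have hcl : closedBall a (s / 6) ⊆ ball a s := closedBall_subset_ball (by linarith)
  have hder : ∀ w ∈ closedBall a (s / 6), ‖deriv G w - deriv G a‖ ≤ D / 2 := by
    intro w hw
    have h1 := Complex.dist_le_div_mul_dist_of_mapsTo_ball (R₂ := 3 * D) (hG'.mono hballsub)
      (fun v hv => by
        rw [mem_closedBall, dist_eq_norm]
        linarith [norm_sub_le (deriv G v) (deriv G a), hle v hv]) (hcl hw)
    rw [dist_eq_norm] at h1
    refine h1.trans ?_
    calc 3 * D / s * dist w a ≤ 3 * D / s * (s / 6) := by gcongr; exact hw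
      _ = D / 2 := by field_simp; norm_num
  have hGd : ∀ w ∈ ball a s, HasDerivAt G (deriv G w) w := fun w hw =>
    (hG.differentiableAt (isOpen_ball.mem_nhds (hballsub hw))).hasDerivAt
  have hlow : ∀ w ∈ sphere a (s / 6), D * s / 12 ≤ ‖G w - G a‖ := by
    intro w hw
    have h1 := (convex_closedBall a (s / 6)).norm_image_sub_le_of_norm_hasDerivWithin_le
      (f := fun w => G w - deriv G a * w) (f' := fun w => deriv G w - deriv G a)
      (fun v hv => ((hGd v (hcl hv)).sub
        (by simpa using (hasDerivAt_id v).const_mul (deriv G a))).hasDerivWithinAt) hder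
      (mem_closedBall_self (by positivity)) (sphere_subset_closedBall hw)
    have hwa : ‖w - a‖ = s / 6 := by rw [← dist_eq_norm]; exact hw
    have h2 : ‖deriv G a * (w - a)‖ = D * (s / 6) := by rw [norm_mul, hwa]
    have h3 := norm_sub_norm_le (deriv G a * (w - a)) (-(G w - deriv G a * w - (G a - deriv G a * a)))
    rw [norm_neg, h2, show deriv G a * (w - a) - -(G w - deriv G a * w - (G a - deriv G a * a))
      = G w - G a by ring] at h3
    rw [hwa] at h1
    linarith
  have hdc : DiffContOnCl ℂ G (ball a (s / 6)) := by
    refine DifferentiableOn.diffContOnCl ?_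
    rw [closure_ball a (by positivity)]
    exact hG.mono (hcl.trans hballsub)
  have hfr : ∃ᶠ w in nhds a, G w ≠ G a :=
    ((hGd a (mem_ball_self hspos)).eventually_ne
      (norm_pos_iff.1 hd0)).frequently.filter_mono nhdsWithin_le_nhds
  have himg := hdc.ball_subset_image_closedBall (by positivity) hlow hfr
  obtain ⟨q, hq, hqn⟩ := hom (G a)
  refine hqn (image_mono (hcl.trans hballsub) (himg ?_))
  rw [mem_ball]
  refine hq.trans_le ?_
  have : (R - ‖a‖) * D = 2 * (D * s) := by rw [hs]; ring
  linarith

/-- The points where `cosh` takes integer values are `4`-dense in the plane. -/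
theorem exists_cosh_eq_intCast_near (p : ℂ) :
    ∃ q : ℂ, dist q p < 4 ∧ ∃ n : ℤ, Complex.cosh q = n := by
  wlog hp : 0 ≤ p.re generalizing p
  · obtain ⟨q, hq, n, hn⟩ := this (-p) (by simp; linarith)
    refine ⟨-q, by rwa [← dist_neg_neg, neg_neg], n, by rw [Complex.cosh_neg, hn]⟩
  set t := p.re with ht
  set n := ⌊Real.cosh t⌋₊ with hn
  have hn1 : (1 : ℝ) ≤ n := by
    exact_mod_cast Nat.le_floor (by exact_mod_cast Real.one_le_cosh t)
  have hnle : (n : ℝ) ≤ Real.cosh t := Nat.floor_le (Real.cosh_pos t).le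
  have hlt : Real.cosh t < n + 1 := Nat.lt_floor_add_one _
  set u := Real.arcosh n with hu
  have hcu : Real.cosh u = n := Real.cosh_arcosh hn1
  have hu0 : 0 ≤ u := Real.arcosh_nonneg hn1
  have hut : u ≤ t := by
    rw [← abs_of_nonneg hu0, ← abs_of_nonneg hp, ← Real.cosh_le_cosh, hcu]; exact hnle
  have htu : t - u < 2 := by
    by_contra! h
    have h1 : Real.cosh t = Real.cosh u * Real.cosh (t - u) + Real.sinh u * Real.sinh (t - u) := by
      rw [← Real.cosh_add]; congr 1; ring
    have h2 : 0 ≤ Real.sinh u * Real.sinh (t - u) :=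
      mul_nonneg (Real.sinh_nonneg_iff.2 hu0) (Real.sinh_nonneg_iff.2 (by linarith))
    have h3 : 2 ≤ Real.cosh (t - u) := by
      have h4 := Real.quadratic_le_exp_of_nonneg (show 0 ≤ t - u by linarith)
      rw [Real.cosh_eq]
      nlinarith [Real.exp_pos (-(t - u))]
    rw [hcu] at h1
    nlinarith
  set k := round (p.im / Real.pi) with hk
  have hk2 : |p.im - k * Real.pi| ≤ Real.pi / 2 := by
    have := abs_sub_round (p.im / Real.pi)
    have h2 : p.im - k * Real.pi = (p.im / Real.pi - k) * Real.pi := by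
      field_simp
    rw [h2, abs_mul, abs_of_pos Real.pi_pos]
    nlinarith [Real.pi_pos]
  refine ⟨u + (k * Real.pi : ℝ) * Complex.I, ?_, ?_⟩
  · rw [dist_eq_norm]
    refine (Complex.norm_le_abs_re_add_abs_im _).trans_lt ?_
    simp only [Complex.sub_re, Complex.add_re, Complex.ofReal_re, Complex.mul_re, Complex.I_re,
      Complex.ofReal_im, Complex.I_im, Complex.sub_im, Complex.add_im, Complex.mul_im]
    rw [abs_sub_comm _ p.im, ← ht]
    have : |u + (k * Real.pi * 0 - 0 * 1) - t| = t - u := by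
      rw [abs_sub_comm, abs_of_nonneg] <;> linarith
    simp only [mul_one, mul_zero, add_zero, zero_add] at this ⊢
    have := Real.pi_lt_four
    norm_num at *
    linarith
  · rw [Complex.cosh_add, Complex.cosh_mul_I, Complex.sinh_mul_I, ← Complex.ofReal_cosh, hcu,
      ← Complex.ofReal_sin, ← Complex.ofReal_cos, Real.sin_int_mul_pi, Real.cos_int_mul_pi]
    rcases Int.even_or_odd k with h | h
    · exact ⟨n, by simp [h.neg_one_zpow]⟩
    · exact ⟨-n, by simp [h.neg_one_zpow]⟩

/-- A **Schottky-type theorem**: a holomorphic function on the unit disk omitting `0` and `1` is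
bounded on smaller disks in terms of its value at the origin. -/
theorem schottky (A : ℝ) {r : ℝ} (hr0 : 0 ≤ r) (hr : r < 1) :
    ∃ B : ℝ, ∀ f : ℂ → ℂ, DifferentiableOn ℂ f (ball 0 1) →
      (∀ z ∈ ball (0 : ℂ) 1, f z ≠ 0) → (∀ z ∈ ball (0 : ℂ) 1, f z ≠ 1) →
      ‖f 0‖ ≤ A → ‖(f 0)⁻¹‖ ≤ A → ∀ z, ‖z‖ ≤ r → ‖f z‖ ≤ B := by
  set A₁ : ℝ := Real.log A + Real.pi with hA₁
  set A₂ : ℝ := Real.log (2 * A₁ + 1) + Real.pi with hA₂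
  set C : ℝ := A₂ + 96 * 4 / (1 - r) * r with hC
  refine ⟨Real.exp (2 * Real.pi * Real.exp C), fun f hf h0 h1 hA hA' z hz => ?_⟩
  have h0R : (0 : ℂ) ∈ ball (0 : ℂ) 1 := mem_ball_self one_pos
  have hzR : z ∈ ball (0 : ℂ) 1 := mem_ball_zero_iff.2 (hz.trans_lt hr)
  have hpi : (Real.pi : ℂ) ≠ 0 := Complex.ofReal_ne_zero.2 Real.pi_ne_zero
  obtain ⟨l, hl, hl0, hlexp⟩ := exists_log_on_ball hf h0
  set w : ℂ → ℂ := fun z => l z / (2 * Real.pi * Complex.I) with hw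
  have hwd : DifferentiableOn ℂ w (ball 0 1) := hl.div_const _
  have hlw : ∀ z, l z = w z * (2 * Real.pi * Complex.I) := fun z => by
    simp only [hw]; rw [div_mul_cancel₀]; simp [hpi]
  have hwint : ∀ z ∈ ball (0 : ℂ) 1, ∀ n : ℤ, w z ≠ n := by
    intro z hz n hn
    refine h1 z hz ?_
    rw [← hlexp z hz, hlw, hn]
    exact Complex.exp_int_mul_two_pi_mul_I n
  have hn2pi : ‖(2 * Real.pi * Complex.I : ℂ)‖ = 2 * Real.pi := by
    simp [abs_of_pos Real.pi_pos]
  have hw0 : ‖w 0‖ ≤ A₁ := by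
    have h2 : ‖l 0‖ ≤ A₁ := hl0 ▸ norm_log_le (h0 0 h0R) hA hA'
    simp only [hw]
    rw [norm_div, hn2pi]
    exact (div_le_self (norm_nonneg _) (by linarith [Real.pi_gt_three])).trans h2
  obtain ⟨m, hm, -, hmexp⟩ := exists_log_on_ball (f := fun z => w z ^ 2 - 1)
    ((hwd.pow 2).sub_const 1) (fun z hz h => by
      have h2 : (w z - 1) * (w z + 1) = 0 := by linear_combination h
      rcases mul_eq_zero.1 h2 with h3 | h3
      · exact hwint z hz 1 (by push_cast; linear_combination h3)
      · exact hwint z hz (-1) (by push_cast; linear_combination h3))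
  set s : ℂ → ℂ := fun z => Complex.exp (m z / 2) with hs
  have hsd : DifferentiableOn ℂ s (ball 0 1) := (hm.div_const 2).cexp
  have hs2 : ∀ z ∈ ball (0 : ℂ) 1, s z ^ 2 = w z ^ 2 - 1 := by
    intro z hz
    rw [← hmexp z hz, hs, ← Complex.exp_nat_mul]
    congr 1; push_cast; ring
  have hmul : ∀ z ∈ ball (0 : ℂ) 1, (w z + s z) * (w z - s z) = 1 := by
    intro z hz
    linear_combination -hs2 z hz
  have hvne : ∀ z ∈ ball (0 : ℂ) 1, w z + s z ≠ 0 := fun z hz =>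
    left_ne_zero_of_mul (hmul z hz ▸ one_ne_zero)
  obtain ⟨G, hG, hG0, hGexp⟩ := exists_log_on_ball (f := fun z => w z + s z) (hwd.add hsd) hvne
  have hcosh : ∀ z ∈ ball (0 : ℂ) 1, Complex.cosh (G z) = w z := by
    intro z hz
    rw [Complex.cosh, Complex.exp_neg, hGexp z hz, inv_eq_of_mul_eq_one_right (hmul z hz)]
    ring
  have hA₁0 : 0 ≤ A₁ := (norm_nonneg _).trans hw0
  have hs0 : ‖s 0‖ ≤ A₁ + 1 := by
    have h2 : ‖s 0‖ ^ 2 ≤ (A₁ + 1) ^ 2 := by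
      rw [← norm_pow, hs2 0 h0R]
      calc ‖w 0 ^ 2 - 1‖ ≤ ‖w 0‖ ^ 2 + 1 := by
            exact (norm_sub_le _ _).trans_eq (by rw [norm_pow, norm_one])
        _ ≤ A₁ ^ 2 + 1 := by gcongr
        _ ≤ _ := by nlinarith
    exact le_of_sq_le_sq h2 (by positivity)
  have hGn : ‖G 0‖ ≤ A₂ := by
    rw [hG0]
    refine norm_log_le (hvne 0 h0R) ((norm_add_le _ _).trans (by linarith)) ?_
    rw [inv_eq_of_mul_eq_one_right (hmul 0 h0R)]
    exact (norm_sub_le _ _).trans (by linarith)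
  have hbloch : ∀ y ∈ closedBall (0 : ℂ) r, ‖deriv G y‖ ≤ 96 * 4 / (1 - r) := by
    intro y hy
    rw [mem_closedBall_zero_iff] at hy
    have h2 := bloch_bound (ρ := 4) hG (fun p => by
      obtain ⟨q, hq, n, hn⟩ := exists_cosh_eq_intCast_near p
      refine ⟨q, hq, ?_⟩
      rintro ⟨x, hx, rfl⟩
      exact hwint x hx n (by rw [← hcosh x hx, hn])) (mem_ball_zero_iff.2 (hy.trans_lt hr))
    rw [le_div_iff₀ (by linarith)]
    nlinarith [norm_nonneg (deriv G y)]
  have hGz : ‖G z‖ ≤ C := by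
    have h2 := (convex_closedBall (0 : ℂ) r).norm_image_sub_le_of_norm_deriv_le
      (fun y hy => hG.differentiableAt
        (isOpen_ball.mem_nhds (closedBall_subset_ball hr hy))) hbloch
      (mem_closedBall_self hr0) (mem_closedBall_zero_iff.2 hz)
    rw [sub_zero] at h2
    have h3 : 96 * 4 / (1 - r) * ‖z‖ ≤ 96 * 4 / (1 - r) * r := by
      have : 0 < 1 - r := by linarith
      gcongr
    have h4 := norm_sub_norm_le (G z) (G 0)
    linarith
  have hwz : ‖w z‖ ≤ Real.exp C := by
    rw [← hcosh z hzR, Complex.cosh, norm_div, Complex.norm_ofNat]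
    have h2 : ∀ u : ℂ, ‖u‖ ≤ C → ‖Complex.exp u‖ ≤ Real.exp C := fun u hu => by
      rw [Complex.norm_exp]
      exact Real.exp_le_exp.2 ((Complex.re_le_norm u).trans hu)
    have := norm_add_le (Complex.exp (G z)) (Complex.exp (-G z))
    linarith [h2 _ hGz, h2 (-G z) (by rwa [norm_neg])]
  rw [← hlexp z hzR, Complex.norm_exp]
  refine Real.exp_le_exp.2 ((Complex.re_le_norm _).trans ?_)
  rw [hlw, norm_mul, hn2pi, mul_comm]
  gcongr


namespace IsHolomorphicMotion

variable {X : Set ℂ} {h : ℂ → ℂ → ℂ}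

theorem exists_norm_le (hh : IsHolomorphicMotion X h) {r : ℝ} (hr : r < 1) {x : ℂ} (hx : x ∈ X) :
    ∃ M, ∀ l ∈ closedBall (0 : ℂ) r, ‖h l x‖ ≤ M :=
  (isCompact_closedBall (0 : ℂ) r).exists_bound_of_continuousOn
    ((hh.2.2 x hx).continuousOn.mono (closedBall_subset_ball hr))

theorem sub_ne_zero (hh : IsHolomorphicMotion X h) {x y : ℂ} (hx : x ∈ X) (hy : y ∈ X)
    (hxy : x ≠ y) {l : ℂ} (hl : l ∈ ball (0 : ℂ) 1) : h l x - h l y ≠ 0 :=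
  _root_.sub_ne_zero.2 fun H => hxy (hh.2.1 l hl hx hy H)

/-- The trajectories starting near a given point are uniformly bounded on smaller disks. -/
theorem locally_bounded (hh : IsHolomorphicMotion X h) (x₀ : ℂ) {r : ℝ} (hr0 : 0 ≤ r)
    (hr : r < 1) : ∃ M, ∃ δ > 0, ∀ x ∈ X, dist x x₀ < δ →
      ∀ l ∈ closedBall (0 : ℂ) r, ‖h l x‖ ≤ M := by
  by_cases hsub : (X \ {x₀}).Subsingleton
  · have hfin : X.Finite := hsub.finite.of_sdiff (finite_singleton x₀)
    choose! M hM using fun x (hx : x ∈ X) => hh.exists_norm_le hr hx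
    obtain ⟨B, hB⟩ := (hfin.image M).bddAbove
    exact ⟨B, 1, one_pos, fun x hx _ l hl => (hM x hx l hl).trans (hB (mem_image_of_mem M hx))⟩
  obtain ⟨a, ⟨ha, hax⟩, b, ⟨hb, hbx⟩, hab⟩ := not_subsingleton_iff.1 hsub
  rw [mem_singleton_iff] at hax hbx
  have hba : b - a ≠ 0 := _root_.sub_ne_zero.2 hab.symm
  set δ : ℝ := dist a x₀ / 2 with hδ
  have hapos : 0 < dist a x₀ := dist_pos.2 hax
  have hbpos : 0 < dist b x₀ := dist_pos.2 hbx
  set A : ℝ := max ((3 * δ) / ‖b - a‖) (‖b - a‖ / δ) with hA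
  obtain ⟨B, hB⟩ := schottky A hr0 hr
  obtain ⟨Ma, hMa⟩ := hh.exists_norm_le hr ha
  obtain ⟨Mb, hMb⟩ := hh.exists_norm_le hr hb
  have hδ0 : 0 < δ := by positivity
  refine ⟨B * (Mb + Ma) + Ma, min δ (dist b x₀), lt_min hδ0 hbpos, fun x hx hxd l hl => ?_⟩
  have hxb : x ≠ b := by
    rintro rfl
    exact absurd hxd (not_lt.2 (min_le_right _ _))
  have hxδ : dist x x₀ < δ := hxd.trans_le (min_le_left _ _)
  have hlow : δ ≤ ‖x - a‖ := by
    rw [← dist_eq_norm]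
    linarith [dist_triangle_left a x₀ x]
  have hup : ‖x - a‖ ≤ 3 * δ := by
    rw [← dist_eq_norm]
    linarith [dist_triangle_right x a x₀]
  have hxa : x ≠ a := by
    rintro rfl
    rw [sub_self, norm_zero] at hlow
    linarith
  have hl' := closedBall_subset_ball hr hl
  have hden := fun l hl => hh.sub_ne_zero hb ha hab.symm (l := l) hl
  have hf := hB (fun l => (h l x - h l a) / (h l b - h l a))
    (((hh.2.2 x hx).sub (hh.2.2 a ha)).div ((hh.2.2 b hb).sub (hh.2.2 a ha)) hden)
    (fun l hl => div_ne_zero (hh.sub_ne_zero hx ha hxa hl) (hden l hl))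
    (fun l hl H => by
      rw [div_eq_one_iff_eq (hden l hl), sub_left_inj] at H
      exact hxb (hh.2.1 l hl hx hb H))
    (by
      simp only [hh.1 x hx, hh.1 a ha, hh.1 b hb, norm_div]
      exact (div_le_div_of_nonneg_right hup (norm_nonneg _)).trans (le_max_left _ _))
    (by
      simp only [hh.1 x hx, hh.1 a ha, hh.1 b hb, inv_div, norm_div]
      exact (div_le_div_of_nonneg_left (norm_nonneg _) hδ0 hlow).trans (le_max_right _ _))
    l (mem_closedBall_zero_iff.1 hl)
  rw [norm_div, div_le_iff₀ (norm_pos_iff.2 (hden l hl'))] at hf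
  have hB0 : 0 ≤ B * ‖h l b - h l a‖ := (norm_nonneg _).trans hf
  have hBnn : 0 ≤ B := nonneg_of_mul_nonneg_left hB0 (norm_pos_iff.2 (hden l hl'))
  have h1 : B * ‖h l b - h l a‖ ≤ B * (Mb + Ma) := by
    gcongr
    exact (norm_sub_le _ _).trans (add_le_add (hMb l hl) (hMa l hl))
  linarith [norm_sub_norm_le (h l x) (h l a), hMa l hl]

theorem equicontinuous (hh : IsHolomorphicMotion X h) (x₀ : ℂ) {r : ℝ} (hr0 : 0 ≤ r)
    (hr : r < 1) {ε : ℝ} (hε : 0 < ε) : ∃ δ > 0, ∀ x ∈ X, dist x x₀ < δ →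
      ∀ y ∈ X, dist y x₀ < δ → ∀ l ∈ closedBall (0 : ℂ) r, dist (h l x) (h l y) < ε := by
  obtain ⟨M, δ, hδ, hM⟩ := hh.locally_bounded x₀ (r := (1 + r) / 2) (by linarith) (by linarith)
  obtain ⟨η, hη, H⟩ := exists_norm_lt_of_norm_zero_lt (R := (1 + r) / 2) (M := 2 * |M| + 1)
    (by positivity) hr0 (by linarith) hε
  refine ⟨min δ (η / 2), lt_min hδ (by positivity), fun x hx hxd y hy hyd l hl => ?_⟩
  rcases eq_or_ne x y with rfl | hxy
  · rwa [dist_self]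
  rw [lt_min_iff] at hxd hyd
  have hsub : ball (0 : ℂ) ((1 + r) / 2) ⊆ ball 0 1 := ball_subset_ball (by linarith)
  rw [dist_eq_norm]
  refine H (fun l => h l x - h l y) (((hh.2.2 x hx).sub (hh.2.2 y hy)).mono hsub)
    (fun z hz => hh.sub_ne_zero hx hy hxy (hsub hz)) (fun z hz => ?_) ?_ l
    (mem_closedBall_zero_iff.1 hl)
  · have := norm_sub_le (h z x) (h z y)
    have h1 := hM x hx hxd.1 z (ball_subset_closedBall hz)
    have h2 := hM y hy hyd.1 z (ball_subset_closedBall hz)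
    linarith [le_abs_self M]
  · simp only [hh.1 x hx, hh.1 y hy]
    rw [← dist_eq_norm]
    linarith [dist_triangle_right x y x₀]

theorem continuousOn (hh : IsHolomorphicMotion X h) :
    ContinuousOn (fun p : ℂ × ℂ => h p.1 p.2) (ball (0 : ℂ) 1 ×ˢ X) := by
  rintro ⟨l₀, x₀⟩ ⟨hl₀, hx₀⟩
  have hl₁ : ‖l₀‖ < 1 := mem_ball_zero_iff.1 hl₀
  rw [Metric.continuousWithinAt_iff']
  intro ε hε
  obtain ⟨δ, hδ, H⟩ := hh.equicontinuous x₀ (r := (1 + ‖l₀‖) / 2) (by positivity) (by linarith)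
    (half_pos hε)
  have hc : ContinuousAt (fun l => h l x₀) l₀ :=
    (hh.2.2 x₀ hx₀).continuousOn.continuousAt (isOpen_ball.mem_nhds hl₀)
  have h1 : ∀ᶠ p : ℂ × ℂ in 𝓝[ball (0 : ℂ) 1 ×ˢ X] (l₀, x₀), p.1 ∈ closedBall 0 ((1 + ‖l₀‖) / 2) :=
    nhdsWithin_le_nhds (continuousAt_fst (closedBall_mem_nhds_of_mem
      (mem_ball_zero_iff.2 (by simp only; linarith))))
  have h2 : ∀ᶠ p : ℂ × ℂ in 𝓝[ball (0 : ℂ) 1 ×ˢ X] (l₀, x₀), dist p.2 x₀ < δ :=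
    nhdsWithin_le_nhds
      ((continuousAt_snd : ContinuousAt Prod.snd (l₀, x₀)) (ball_mem_nhds x₀ hδ))
  have h3 : ∀ᶠ p : ℂ × ℂ in 𝓝[ball (0 : ℂ) 1 ×ˢ X] (l₀, x₀), dist (h p.1 x₀) (h l₀ x₀) < ε / 2 :=
    nhdsWithin_le_nhds ((hc.comp (f := Prod.fst) (x := (l₀, x₀)) continuousAt_fst)
      (ball_mem_nhds (h l₀ x₀) (half_pos hε)))
  filter_upwards [h1, h2, h3, self_mem_nhdsWithin] with p hp1 hp2 hp3 hp
  have := H p.2 hp.2 hp2 x₀ hx₀ (by rwa [dist_self]) p.1 hp1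
  linarith [dist_triangle (h p.1 p.2) (h p.1 x₀) (h l₀ x₀)]

theorem tendsto_extendFrom (hh : IsHolomorphicMotion X h) {x : ℂ} (hx : x ∈ closure X) {l : ℂ}
    (hl : l ∈ ball (0 : ℂ) 1) : Tendsto (h l) (𝓝[X] x) (𝓝 (extendFrom X (h l) x)) := by
  have : (𝓝[X] x).NeBot := mem_closure_iff_nhdsWithin_neBot.1 hx
  refine _root_.tendsto_extendFrom (cauchy_map_iff_exists_tendsto.1 (Metric.cauchy_iff.2
    ⟨inferInstance, fun ε hε => ?_⟩))
  obtain ⟨δ, hδ, H⟩ := hh.equicontinuous x (norm_nonneg l) (mem_ball_zero_iff.1 hl) hε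
  refine ⟨h l '' (ball x δ ∩ X), image_mem_map
    (inter_mem (nhdsWithin_le_nhds (ball_mem_nhds x hδ)) self_mem_nhdsWithin), ?_⟩
  rintro _ ⟨y, ⟨hyd, hy⟩, rfl⟩ _ ⟨z, ⟨hzd, hz⟩, rfl⟩
  exact H y hy hyd z hz hzd l (mem_closedBall_zero_iff.2 le_rfl)

theorem tendstoLocallyUniformlyOn_extendFrom (hh : IsHolomorphicMotion X h) {x : ℂ}
    (hx : x ∈ closure X) :
    TendstoLocallyUniformlyOn (fun y l => h l y) (fun l => extendFrom X (h l) x) (𝓝[X] x)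
      (ball (0 : ℂ) 1) := by
  have : (𝓝[X] x).NeBot := mem_closure_iff_nhdsWithin_neBot.1 hx
  rw [Metric.tendstoLocallyUniformlyOn_iff]
  intro ε hε l₀ hl₀
  have hl₁ : ‖l₀‖ < 1 := mem_ball_zero_iff.1 hl₀
  obtain ⟨δ, hδ, H⟩ := hh.equicontinuous x (r := (1 + ‖l₀‖) / 2) (by positivity) (by linarith)
    (half_pos hε)
  have hnear : ∀ᶠ y in 𝓝[X] x, dist y x < δ ∧ y ∈ X :=
    (eventually_nhdsWithin_of_eventually_nhds (ball_mem_nhds x hδ)).and self_mem_nhdsWithin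
  refine ⟨closedBall 0 ((1 + ‖l₀‖) / 2), nhdsWithin_le_nhds (closedBall_mem_nhds_of_mem
      (mem_ball_zero_iff.2 (by linarith))), hnear.mono fun y hy l hl => ?_⟩
  have hlim := (hh.tendsto_extendFrom hx
    (closedBall_subset_ball (by linarith) hl)).dist (tendsto_const_nhds (x := h l y))
  have := le_of_tendsto hlim (hnear.mono fun z hz => (H z hz.2 hz.1 y hy.2 hy.1 l hl).le)
  linarith

theorem extendFrom_eq (hh : IsHolomorphicMotion X h) {x : ℂ} (hx : x ∈ X) {l : ℂ}
    (hl : l ∈ ball (0 : ℂ) 1) : extendFrom X (h l) x = h l x :=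
  _root_.extendFrom_eq (subset_closure hx) <|
    (hh.continuousOn.comp (f := fun y => (l, y)) (by fun_prop) fun _ hy => ⟨hl, hy⟩) x hx

theorem extendFrom_ne (hh : IsHolomorphicMotion X h) {x y : ℂ} (hx : x ∈ closure X)
    (hy : y ∈ closure X) (hxy : x ≠ y) {l : ℂ} (hl : l ∈ ball (0 : ℂ) 1) :
    extendFrom X (h l) x ≠ extendFrom X (h l) y := by
  have : (𝓝[X] x).NeBot := mem_closure_iff_nhdsWithin_neBot.1 hx
  have : (𝓝[X] y).NeBot := mem_closure_iff_nhdsWithin_neBot.1 hy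
  have hl₁ : ‖l‖ < 1 := mem_ball_zero_iff.1 hl
  set R := (1 + ‖l‖) / 2 with hR
  have hR1 : R < 1 := by linarith
  have hd : 0 < dist x y := dist_pos.2 hxy
  obtain ⟨M, δ, hδ, hM⟩ := hh.locally_bounded x (r := R) (by positivity) hR1
  obtain ⟨M', δ', hδ', hM'⟩ := hh.locally_bounded y (r := R) (by positivity) hR1
  obtain ⟨ε, hε, H⟩ := exists_le_norm_of_le_norm_zero (R := R) (M := |M| + |M'| + 1) (r := ‖l‖)
    (by positivity) (by linarith) (half_pos hd)
  have hsub : ball (0 : ℂ) R ⊆ ball 0 1 := ball_subset_ball hR1.le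
  have hlim := ((hh.tendsto_extendFrom hx hl).comp tendsto_fst).sub
    ((hh.tendsto_extendFrom hy hl).comp (tendsto_snd (f := 𝓝[X] x)))
  have hnx : ∀ᶠ p : ℂ × ℂ in 𝓝[X] x ×ˢ 𝓝[X] y, dist p.1 x < min δ (dist x y / 4) ∧ p.1 ∈ X :=
    tendsto_fst.eventually ((eventually_nhdsWithin_of_eventually_nhds
      (ball_mem_nhds x (by positivity))).and self_mem_nhdsWithin)
  have hny : ∀ᶠ p : ℂ × ℂ in 𝓝[X] x ×ˢ 𝓝[X] y, dist p.2 y < min δ' (dist x y / 4) ∧ p.2 ∈ X :=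
    tendsto_snd.eventually ((eventually_nhdsWithin_of_eventually_nhds
      (ball_mem_nhds y (by positivity))).and self_mem_nhdsWithin)
  have hge : ε ≤ ‖extendFrom X (h l) x - extendFrom X (h l) y‖ := by
    refine ge_of_tendsto hlim.norm ?_
    filter_upwards [hnx, hny] with p hp hq
    rw [lt_min_iff] at hp hq
    have hpq : dist x y / 2 ≤ dist p.1 p.2 := by
      linarith [dist_triangle4 x p.1 p.2 y, dist_comm x p.1]
    have hne : p.1 ≠ p.2 := dist_pos.1 ((half_pos hd).trans_le hpq)
    refine H (fun z => h z p.1 - h z p.2)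
      (((hh.2.2 _ hp.2).sub (hh.2.2 _ hq.2)).mono hsub)
      (fun z hz => hh.sub_ne_zero hp.2 hq.2 hne (hsub hz)) (fun z hz => ?_) ?_ l le_rfl
    · have h0 := norm_sub_le (h z p.1) (h z p.2)
      have h1 := hM _ hp.2 hp.1.1 z (ball_subset_closedBall hz)
      have h2 := hM' _ hq.2 hq.1.1 z (ball_subset_closedBall hz)
      linarith [le_abs_self M, le_abs_self M']
    · simp only [hh.1 _ hp.2, hh.1 _ hq.2]
      rwa [← dist_eq_norm]
  exact _root_.sub_ne_zero.1 (norm_pos_iff.1 (hε.trans_le hge))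

theorem closure_extendFrom (hh : IsHolomorphicMotion X h) :
    IsHolomorphicMotion (closure X) (fun l => extendFrom X (h l)) := by
  refine ⟨fun x hx => ?_, fun l hl x hx y hy hxy => ?_, fun x hx => ?_⟩
  · refine _root_.extendFrom_eq hx ((tendsto_nhdsWithin_of_tendsto_nhds tendsto_id).congr' ?_)
    filter_upwards [self_mem_nhdsWithin] with y hy using (hh.1 y hy).symm
  · by_contra hne
    exact hh.extendFrom_ne hx hy hne hl hxy
  · have : (𝓝[X] x).NeBot := mem_closure_iff_nhdsWithin_neBot.1 hx
    refine (hh.tendstoLocallyUniformlyOn_extendFrom hx).differentiableOn ?_ isOpen_ball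
    filter_upwards [self_mem_nhdsWithin] with y hy using hh.2.2 y hy

theorem eqOn_closure {H H' : ℂ → ℂ → ℂ} (hH : IsHolomorphicMotion (closure X) H)
    (hH' : IsHolomorphicMotion (closure X) H') {l : ℂ} (hl : l ∈ ball (0 : ℂ) 1)
    (heq : EqOn (H l) (H' l) X) : EqOn (H l) (H' l) (closure X) := by
  have hc : ∀ {K : ℂ → ℂ → ℂ}, IsHolomorphicMotion (closure X) K → ContinuousOn (K l) (closure X) :=
    fun hK => hK.continuousOn.comp (f := fun y => (l, y)) (by fun_prop) fun _ hy => ⟨hl, hy⟩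
  exact heq.of_subset_closure (hc hH) (hc hH') subset_closure subset_rfl

end IsHolomorphicMotion

end

/-- **the λ-lemma, restriction to the closure.** For every holomorphic
motion `h` of `X ⊆ ℂ` over `𝔻` there exists a holomorphic motion `H` of the closure of
`X` over `𝔻` extending `h`; this extension is unique (on `𝔻 × closure X`), and `H` is
jointly continuous as a map `𝔻 × closure X → ℂ`. -/
theorem stmt_15 (X : Set ℂ) (h : ℂ → ℂ → ℂ) (hh : IsHolomorphicMotion X h) :
    ∃ H : ℂ → ℂ → ℂ,
      IsHolomorphicMotion (closure X) H ∧
      (∀ l ∈ Metric.ball (0 : ℂ) 1, ∀ x ∈ X, H l x = h l x) ∧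
      ContinuousOn (fun p : ℂ × ℂ => H p.1 p.2) (Metric.ball (0 : ℂ) 1 ×ˢ closure X) ∧
      ∀ H' : ℂ → ℂ → ℂ,
        IsHolomorphicMotion (closure X) H' →
        (∀ l ∈ Metric.ball (0 : ℂ) 1, ∀ x ∈ X, H' l x = h l x) →
        ∀ l ∈ Metric.ball (0 : ℂ) 1, ∀ x ∈ closure X, H' l x = H l x := by
  exact ⟨fun l => extendFrom X (h l), hh.closure_extendFrom, fun l hl x hx => hh.extendFrom_eq hx hl,
    hh.closure_extendFrom.continuousOn, fun H' hH' heq l hl x hx =>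
      hH'.eqOn_closure hh.closure_extendFrom hl
        (fun y hy => (heq l hl y hy).trans (hh.extendFrom_eq hy hl).symm) hx⟩
end
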